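/- For large T > 0 one has ∫₀^T Z²(t) ζ(1/2+it) dt = 2π ∑_{k ≤ T/(2π)} d₃(k) + O(T^{3/4} log³ T). -/

import Mathlib

open Complex Filter Real MeasureTheory Finset

noncomputable def chi (s : ℂ) : ℂ :=
  2 ^ s * (π : ℂ) ^ (s - 1) * Complex.sin (π * s / 2) * Complex.Gamma (1 - s)

noncomputable def Z (t : ℝ) : ℂ :=
  chi (1 / 2 + I * t) ^ (-(1 / 2 : ℂ)) * riemannZeta (1 / 2 + I * t)

/-- number of positive divisors -/
noncomputable def d (k : ℕ) : ℕ := k.divisors.card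

/-- number of ordered triples of positive integers with product `n` -/
noncomputable def d3 (n : ℕ) : ℕ :=
  ((Finset.Icc 1 n ×ˢ Finset.Icc 1 n ×ˢ Finset.Icc 1 n).filter
    fun p : ℕ × ℕ × ℕ => p.1 * p.2.1 * p.2.2 = n).card

/-- sum over integers `a ≤ k ≤ b` where terms at integer endpoints are halved -/
noncomputable def psum (a b : ℝ) (f : ℕ → ℂ) : ℂ :=
  ∑ k ∈ Finset.Icc ⌈a⌉₊ ⌊b⌋₊,
    (if (k : ℝ) = a ∨ (k : ℝ) = b then (1 / 2 : ℂ) else 1) * f k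

theorem norm_le_of_strip_of_bounded {f : ℂ → ℂ} {a b C B : ℝ} (hab : a < b)
    (hd : ∀ z : ℂ, a ≤ z.re → z.re ≤ b → DifferentiableAt ℂ f z)
    (hB : ∀ z : ℂ, a ≤ z.re → z.re ≤ b → ‖f z‖ ≤ B)
    (ha : ∀ z : ℂ, z.re = a → ‖f z‖ ≤ C) (hb : ∀ z : ℂ, z.re = b → ‖f z‖ ≤ C)
    {z : ℂ} (hza : a ≤ z.re) (hzb : z.re ≤ b) : ‖f z‖ ≤ C := by
  refine PhragmenLindelof.vertical_strip (f := f) (a := a) (b := b) ?_ ?_ ha hb hza hzb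
  · have hcl : closure (Complex.re ⁻¹' Set.Ioo a b) ⊆ Complex.re ⁻¹' Set.Icc a b :=
      closure_minimal (Set.preimage_mono Set.Ioo_subset_Icc_self)
        (isClosed_Icc.preimage Complex.continuous_re)
    refine ⟨fun z hz => ?_, fun z hz => ?_⟩
    · exact (hd z hz.1.le hz.2.le).differentiableWithinAt
    · exact (hd z (hcl hz).1 (hcl hz).2).continuousAt.continuousWithinAt
  · refine ⟨0, div_pos Real.pi_pos (sub_pos.2 hab), 0, ?_⟩
    refine Asymptotics.IsBigO.of_bound B ?_
    filter_upwards [mem_inf_of_right (mem_principal_self _)] with z hz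
    simpa using hB z hz.1.le hz.2.le

theorem norm_Gamma_le_Gamma_re {s : ℂ} (hs : 0 < s.re) :
    ‖Complex.Gamma s‖ ≤ Real.Gamma s.re := by
  rw [Complex.Gamma_eq_integral hs, Complex.GammaIntegral, Real.Gamma_eq_integral hs]
  refine (norm_integral_le_integral_norm _).trans_eq ?_
  refine setIntegral_congr_fun measurableSet_Ioi fun x hx => ?_
  have hx' : (0 : ℝ) < x := hx
  simp only [norm_mul, Complex.norm_real, Real.norm_eq_abs, abs_of_pos (Real.exp_pos _)]
  rw [Complex.norm_cpow_eq_rpow_re_of_pos hx']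
  simp

theorem norm_sin_half_pi_add (t : ℝ) :
    Complex.sin (Real.pi * (1 / 2 + t * I)) = (Real.cosh (Real.pi * t) : ℂ) := by
  have : (Real.pi : ℂ) * (1 / 2 + t * I) = ((Real.pi * t : ℝ) : ℂ) * I + Real.pi / 2 := by
    push_cast; ring
  rw [this, Complex.sin_add_pi_div_two, Complex.cos_mul_I, Complex.ofReal_cosh]

theorem norm_Gamma_half_add_sq (t : ℝ) :
    ‖Complex.Gamma (1 / 2 + t * I)‖ ^ 2 = Real.pi / Real.cosh (Real.pi * t) := by
  have h1 : (1 : ℂ) - (1 / 2 + t * I) = (starRingEnd ℂ) (1 / 2 + t * I) := by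
    apply Complex.ext <;> norm_num
  have h := Complex.Gamma_mul_Gamma_one_sub (1 / 2 + t * I)
  rw [h1, Complex.Gamma_conj, Complex.mul_conj, norm_sin_half_pi_add,
    Complex.normSq_eq_norm_sq] at h
  exact_mod_cast h

theorem exp_abs_le_two_mul_cosh (x : ℝ) : Real.exp |x| ≤ 2 * Real.cosh x := by
  rw [← Real.cosh_abs, Real.cosh_eq]
  have := Real.exp_pos (-|x|)
  linarith

theorem norm_Gamma_half_add_le (t : ℝ) :
    ‖Complex.Gamma (1 / 2 + t * I)‖ ≤ 3 * Real.exp (-(Real.pi * |t| / 2)) := by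
  refine abs_le_of_sq_le_sq' ?_ (by positivity) |>.2
  rw [norm_Gamma_half_add_sq, mul_pow, ← Real.exp_nat_mul,
    div_le_iff₀ (Real.cosh_pos _)]
  have h := exp_abs_le_two_mul_cosh (Real.pi * t)
  rw [abs_mul, abs_of_pos Real.pi_pos] at h
  have h2 : Real.exp (((2 : ℕ) : ℝ) * -(Real.pi * |t| / 2)) * Real.exp (Real.pi * |t|) = 1 := by
    rw [← Real.exp_add, Real.exp_eq_one_iff]; push_cast; ring
  have h3 := Real.exp_pos (((2 : ℕ) : ℝ) * -(Real.pi * |t| / 2))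
  have h4 := Real.pi_lt_four
  nlinarith [mul_le_mul_of_nonneg_left h h3.le]

theorem norm_Gamma_three_halves_add_le (t : ℝ) :
    ‖Complex.Gamma (3 / 2 + t * I)‖ ≤ 3 * (1 + |t|) * Real.exp (-(Real.pi * |t| / 2)) := by
  have hne : (1 / 2 + t * I : ℂ) ≠ 0 := by
    intro h
    have := congrArg Complex.re h
    norm_num at this
  have h : (3 / 2 + t * I : ℂ) = (1 / 2 + t * I) + 1 := by ring
  rw [h, Complex.Gamma_add_one _ hne, norm_mul]
  have h1 : ‖(1 / 2 + t * I : ℂ)‖ ≤ 1 + |t| := by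
    refine (norm_add_le _ _).trans ?_
    simp
    norm_num
  calc _ ≤ (1 + |t|) * (3 * Real.exp (-(Real.pi * |t| / 2))) :=
        mul_le_mul h1 (norm_Gamma_half_add_le t) (norm_nonneg _) (by positivity)
    _ = _ := by ring

theorem norm_exp_sq (w : ℂ) : ‖Complex.exp (w ^ 2)‖ = Real.exp (w.re ^ 2 - w.im ^ 2) := by
  rw [Complex.norm_exp]
  simp [sq]

theorem norm_Gamma_le_of_mem_Icc :
    ∀ σ : ℝ, 1 / 2 ≤ σ → σ ≤ 3 / 2 → ∀ t : ℝ,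
      ‖Complex.Gamma (σ + t * I)‖ ≤
        3 * Real.exp 7 * (1 + |t|) ^ (σ - 1 / 2) * Real.exp (-(Real.pi * |t| / 2)) := by
  intro σ hσ1 hσ2 T
  have hT : 0 < 1 + |T| := by positivity
  set f : ℂ → ℂ := fun w => Complex.Gamma (w + T * I) * Complex.exp (w ^ 2) *
    Complex.exp (-(w - 1 / 2) * (Real.log (1 + |T|) : ℂ)) with hf
  have hthird : ∀ w : ℂ, ‖Complex.exp (-(w - 1 / 2) * (Real.log (1 + |T|) : ℂ))‖ =
      (1 + |T|) ^ (-(w.re - 1 / 2)) := by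
    intro w
    rw [Complex.norm_exp, Real.rpow_def_of_pos hT]
    congr 1
    simp
    ring
  have hexp : ∀ v : ℝ, Real.exp (-(Real.pi * |T + v| / 2)) ≤
      Real.exp (-(Real.pi * |T| / 2)) * Real.exp (2 * |v|) := by
    intro v
    rw [← Real.exp_add]
    apply Real.exp_le_exp.2
    have h1 : |T| ≤ |T + v| + |v| := by
      have := abs_sub (T + v) v
      simpa using this
    nlinarith [Real.pi_pos, Real.pi_lt_four, abs_nonneg v, abs_nonneg (T + v)]
  obtain ⟨B, hB⟩ : ∃ B, ∀ x ∈ Set.Icc (1 / 2 : ℝ) (3 / 2), ‖Real.Gamma x‖ ≤ B := by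
    apply isCompact_Icc.exists_bound_of_continuousOn
    intro x hx
    have hx0 : 0 < x := by have := hx.1; linarith
    refine (Real.differentiableAt_Gamma fun m => ?_).continuousAt.continuousWithinAt
    have : (0 : ℝ) ≤ m := m.cast_nonneg
    linarith
  have key : ‖f σ‖ ≤ 3 * Real.exp 7 * Real.exp (-(Real.pi * |T| / 2)) := by
    refine norm_le_of_strip_of_bounded (a := 1 / 2) (b := 3 / 2) (B := B * Real.exp 4) (by norm_num)
      ?_ ?_ ?_ ?_ (by simpa using hσ1) (by simpa using hσ2)
    · intro z h1 h2
      have : DifferentiableAt ℂ Complex.Gamma (z + T * I) := by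
        apply Complex.differentiableAt_Gamma
        intro m h
        have := congrArg Complex.re h
        simp at this
        have h0 : (0 : ℝ) ≤ m := m.cast_nonneg
        linarith
      have h2 : DifferentiableAt ℂ (fun w : ℂ => Complex.Gamma (w + T * I)) z :=
        DifferentiableAt.comp z (f := fun w : ℂ => w + T * I) this (by fun_prop)
      simp only [hf]
      fun_prop
    · intro z h1 h2
      simp only [hf, norm_mul, hthird, norm_exp_sq]
      have e1 : ‖Complex.Gamma (z + T * I)‖ ≤ B := by
        refine (norm_Gamma_le_Gamma_re (by simp; linarith)).trans ?_
        refine (le_abs_self _).trans (hB _ ?_)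
        simpa using ⟨by simpa using h1, h2⟩
      have e2 : Real.exp (z.re ^ 2 - z.im ^ 2) ≤ Real.exp 4 := by
        apply Real.exp_le_exp.2
        nlinarith [sq_nonneg z.im]
      have e3 : (1 + |T|) ^ (-(z.re - 1 / 2)) ≤ 1 := by
        apply Real.rpow_le_one_of_one_le_of_nonpos
        · linarith [abs_nonneg T]
        · linarith
      have hB0 : 0 ≤ B := (norm_nonneg _).trans e1
      calc _ ≤ B * Real.exp 4 * 1 := by gcongr
        _ = _ := by ring
    · intro z hz
      simp only [hf, norm_mul, hthird, norm_exp_sq]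
      have hzz : z + T * I = 1 / 2 + ((T + z.im : ℝ) : ℂ) * I := by
        apply Complex.ext <;> simp [hz]; ring
      rw [hzz, hz]
      have e1 := norm_Gamma_half_add_le (T + z.im)
      have e2 := hexp z.im
      have e3 : Real.exp (2 * |z.im|) * Real.exp ((1 / 2 : ℝ) ^ 2 - z.im ^ 2) ≤ Real.exp 7 := by
        rw [← Real.exp_add]
        apply Real.exp_le_exp.2
        nlinarith [sq_nonneg (|z.im| - 1), sq_abs z.im]
      have e4 : (1 + |T|) ^ (-((1 / 2 : ℝ) - 1 / 2)) = 1 := by simp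
      rw [e4]
      calc _ ≤ (3 * (Real.exp (-(Real.pi * |T| / 2)) * Real.exp (2 * |z.im|))) *
            Real.exp ((1 / 2 : ℝ) ^ 2 - z.im ^ 2) * 1 := by
              gcongr
              exact e1.trans (by gcongr)
        _ = 3 * Real.exp (-(Real.pi * |T| / 2)) * (Real.exp (2 * |z.im|) *
            Real.exp ((1 / 2 : ℝ) ^ 2 - z.im ^ 2)) := by ring
        _ ≤ 3 * Real.exp (-(Real.pi * |T| / 2)) * Real.exp 7 := by gcongr
        _ = _ := by ring
    · intro z hz
      simp only [hf, norm_mul, hthird, norm_exp_sq]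
      have hzz : z + T * I = 3 / 2 + ((T + z.im : ℝ) : ℂ) * I := by
        apply Complex.ext <;> simp [hz]; ring
      rw [hzz, hz]
      have e1 := norm_Gamma_three_halves_add_le (T + z.im)
      have e2 := hexp z.im
      have e3 : Real.exp |z.im| * Real.exp (2 * |z.im|) *
          Real.exp ((3 / 2 : ℝ) ^ 2 - z.im ^ 2) ≤ Real.exp 7 := by
        rw [← Real.exp_add, ← Real.exp_add]
        apply Real.exp_le_exp.2
        nlinarith [sq_nonneg (|z.im| - 3 / 2), sq_abs z.im]
      have e4 : (1 + |T|) ^ (-((3 / 2 : ℝ) - 1 / 2)) = (1 + |T|)⁻¹ := by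
        rw [← Real.rpow_neg_one]; norm_num
      have e5 : 1 + |T + z.im| ≤ (1 + |T|) * Real.exp |z.im| := by
        have h1 := abs_add_le T z.im
        have h2 := Real.add_one_le_exp |z.im|
        nlinarith [abs_nonneg T, abs_nonneg z.im]
      rw [e4]
      calc _ ≤ (3 * ((1 + |T|) * Real.exp |z.im|) *
            (Real.exp (-(Real.pi * |T| / 2)) * Real.exp (2 * |z.im|))) *
            Real.exp ((3 / 2 : ℝ) ^ 2 - z.im ^ 2) * (1 + |T|)⁻¹ := by
              gcongr
              exact e1.trans (by gcongr)
        _ = 3 * Real.exp (-(Real.pi * |T| / 2)) * (Real.exp |z.im| * Real.exp (2 * |z.im|) *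
            Real.exp ((3 / 2 : ℝ) ^ 2 - z.im ^ 2)) := by field_simp
        _ ≤ 3 * Real.exp (-(Real.pi * |T| / 2)) * Real.exp 7 := by gcongr
        _ = _ := by ring
  simp only [hf, norm_mul, hthird, norm_exp_sq] at key
  simp only [Complex.ofReal_re, Complex.ofReal_im] at key
  have e1 : 1 ≤ Real.exp (σ ^ 2 - 0 ^ 2) := Real.one_le_exp (by nlinarith)
  have e2 : (1 + |T|) ^ (-(σ - 1 / 2)) * (1 + |T|) ^ (σ - 1 / 2) = 1 := by
    rw [← Real.rpow_add hT]; simp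
  have e3 : 0 ≤ (1 + |T|) ^ (σ - 1 / 2) := by positivity
  calc ‖Complex.Gamma (σ + T * I)‖
      = ‖Complex.Gamma (σ + T * I)‖ * 1 * ((1 + |T|) ^ (-(σ - 1 / 2)) *
        (1 + |T|) ^ (σ - 1 / 2)) := by rw [e2]; ring
    _ ≤ ‖Complex.Gamma (σ + T * I)‖ * Real.exp (σ ^ 2 - 0 ^ 2) * ((1 + |T|) ^ (-(σ - 1 / 2)) *
        (1 + |T|) ^ (σ - 1 / 2)) := by gcongr
    _ = ‖Complex.Gamma (σ + T * I)‖ * Real.exp (σ ^ 2 - 0 ^ 2) * (1 + |T|) ^ (-(σ - 1 / 2)) *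
        (1 + |T|) ^ (σ - 1 / 2) := by ring
    _ ≤ 3 * Real.exp 7 * Real.exp (-(Real.pi * |T| / 2)) * (1 + |T|) ^ (σ - 1 / 2) := by gcongr
    _ = _ := by ring

/-- Uniform upper bound for the Gamma function on vertical lines, with the sharp exponential and
polynomial decay. -/
theorem exists_norm_Gamma_le :
    ∃ C : ℝ, 0 < C ∧ ∀ σ : ℝ, 1 / 4 ≤ σ → σ ≤ 5 / 2 → ∀ t : ℝ,
      ‖Complex.Gamma (σ + t * I)‖ ≤
        C * (1 + |t|) ^ (σ - 1 / 2) * Real.exp (-(Real.pi * |t| / 2)) := by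
  refine ⟨15 * Real.exp 7, by positivity, fun σ h1 h2 t => ?_⟩
  have ht : 0 < 1 + |t| := by positivity
  rcases lt_or_ge σ (1 / 2) with h | h
  · have hb := norm_Gamma_le_of_mem_Icc (σ + 1) (by linarith) (by linarith) t
    have hne : (σ + t * I : ℂ) ≠ 0 := by
      intro h
      have := congrArg Complex.re h
      simp at this; linarith
    have e : (((σ + 1 : ℝ) : ℂ) + t * I) = (σ + t * I) + 1 := by push_cast; ring
    rw [e, Complex.Gamma_add_one _ hne, norm_mul] at hb
    have hn : (1 + |t|) / 5 ≤ ‖(σ + t * I : ℂ)‖ := by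
      have a1 := Complex.abs_re_le_norm (σ + t * I)
      have a2 := Complex.abs_im_le_norm (σ + t * I)
      simp at a1 a2
      rw [abs_of_pos (by linarith : 0 < σ)] at a1
      linarith
    have e6 : (1 + |t|) ^ (σ + 1 - 1 / 2) = (1 + |t|) * (1 + |t|) ^ (σ - 1 / 2) := by
      rw [← Real.rpow_one_add' ht.le (by linarith)]; congr 1; ring
    rw [e6] at hb
    have h7 : (1 + |t|) / 5 * ‖Complex.Gamma (σ + t * I)‖ ≤ (1 + |t|) / 5 *
        (15 * Real.exp 7 * (1 + |t|) ^ (σ - 1 / 2) * Real.exp (-(Real.pi * |t| / 2))) := by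
      refine (mul_le_mul_of_nonneg_right hn (norm_nonneg _)).trans (hb.trans_eq ?_)
      ring
    exact le_of_mul_le_mul_left h7 (by positivity)
  rcases le_or_gt σ (3 / 2) with h' | h'
  · refine (norm_Gamma_le_of_mem_Icc σ h h' t).trans ?_
    gcongr
    norm_num
  · have hb := norm_Gamma_le_of_mem_Icc (σ - 1) (by linarith) (by linarith) t
    have hne : (((σ - 1 : ℝ) : ℂ) + t * I : ℂ) ≠ 0 := by
      intro h
      have := congrArg Complex.re h
      simp at this; linarith
    have e : (σ + t * I : ℂ) = (((σ - 1 : ℝ) : ℂ) + t * I) + 1 := by push_cast; ring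
    rw [e, Complex.Gamma_add_one _ hne, norm_mul]
    have hn : ‖(((σ - 1 : ℝ) : ℂ) + t * I : ℂ)‖ ≤ 2 * (1 + |t|) := by
      refine (norm_add_le _ _).trans ?_
      rw [norm_mul, Complex.norm_real, Complex.norm_real, Complex.norm_I, Real.norm_eq_abs,
        Real.norm_eq_abs, abs_of_pos (by linarith : 0 < σ - 1)]
      linarith [abs_nonneg t]
    have e6 : (1 + |t|) ^ (σ - 1 / 2) = (1 + |t|) * (1 + |t|) ^ (σ - 1 - 1 / 2) := by
      rw [← Real.rpow_one_add' ht.le (by linarith)]; congr 1; ring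
    rw [e6]
    calc _ ≤ 2 * (1 + |t|) * (3 * Real.exp 7 * (1 + |t|) ^ (σ - 1 - 1 / 2) *
          Real.exp (-(Real.pi * |t| / 2))) := by gcongr
      _ = 6 * Real.exp 7 * ((1 + |t|) * (1 + |t|) ^ (σ - 1 - 1 / 2)) *
          Real.exp (-(Real.pi * |t| / 2)) := by ring
      _ ≤ _ := by gcongr; norm_num

/-- Matching lower bound for the Gamma function, obtained from the reflection formula. -/
theorem exists_le_norm_Gamma :
    ∃ c : ℝ, 0 < c ∧ ∀ σ : ℝ, 1 / 4 ≤ σ → σ ≤ 3 / 4 → ∀ t : ℝ,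
      c * (1 + |t|) ^ (σ - 1 / 2) * Real.exp (-(Real.pi * |t| / 2)) ≤
        ‖Complex.Gamma (σ + t * I)‖ := by
  obtain ⟨C, hC, hb⟩ := exists_norm_Gamma_le
  refine ⟨Real.pi / C, by positivity, fun σ h1 h2 t => ?_⟩
  have ht : 0 < 1 + |t| := by positivity
  have h := Complex.Gamma_mul_Gamma_one_sub (σ + t * I)
  have hb' := hb (1 - σ) (by linarith) (by linarith) (-t)
  have e : (1 : ℂ) - (σ + t * I) = ((1 - σ : ℝ) : ℂ) + ((-t : ℝ) : ℂ) * I := by push_cast; ring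
  rw [← e, abs_neg] at hb'
  have hsin : ‖Complex.sin (Real.pi * (σ + t * I))‖ ≤ Real.exp (Real.pi * |t|) := by
    have : ∀ z : ℂ, ‖Complex.sin z‖ ≤ Real.exp |z.im| := by
      intro z
      rw [Complex.sin, norm_div, norm_mul, Complex.norm_I, mul_one]
      have n1 : ‖Complex.exp (-z * I)‖ ≤ Real.exp |z.im| := by
        rw [Complex.norm_exp]; apply Real.exp_le_exp.2; simpa using le_abs_self _
      have n2 : ‖Complex.exp (z * I)‖ ≤ Real.exp |z.im| := by
        rw [Complex.norm_exp]; apply Real.exp_le_exp.2; simpa using neg_le_abs _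
      have n3 := norm_sub_le (Complex.exp (-z * I)) (Complex.exp (z * I))
      have n4 : ‖(2 : ℂ)‖ = 2 := by simp
      rw [n4]
      linarith
    refine (this _).trans_eq ?_
    simp [abs_mul, abs_of_pos Real.pi_pos]
  have hsin0 : Complex.sin (Real.pi * (σ + t * I)) ≠ 0 := by
    intro h0
    rw [Complex.sin_eq_zero_iff] at h0
    obtain ⟨k, hk⟩ := h0
    have := congrArg Complex.re hk
    simp at this
    have h3 : σ = k := by
      have hp := Real.pi_pos
      nlinarith
    have h4 : (0 : ℝ) < k := by linarith
    have h5 : (k : ℝ) < 1 := by linarith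
    have h6 : 0 < k := by exact_mod_cast h4
    have h7 : k < 1 := by exact_mod_cast h5
    omega
  have hn := congrArg norm h
  rw [norm_mul, norm_div, Complex.norm_real, Real.norm_eq_abs, abs_of_pos Real.pi_pos,
    eq_div_iff (norm_ne_zero_iff.2 hsin0)] at hn
  set X := ‖Complex.Gamma (σ + t * I)‖
  have hX : 0 ≤ X := norm_nonneg _
  have e2 : (1 + |t|) ^ (1 - σ - 1 / 2) * (1 + |t|) ^ (σ - 1 / 2) = 1 := by
    rw [← Real.rpow_add ht]; ring_nf; simp
  have e3 : Real.exp (-(Real.pi * |t| / 2)) * Real.exp (-(Real.pi * |t| / 2)) *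
      Real.exp (Real.pi * |t|) = 1 := by
    rw [← Real.exp_add, ← Real.exp_add]; ring_nf; simp
  have h8 : Real.pi ≤ X * (C * (1 + |t|) ^ (1 - σ - 1 / 2) * Real.exp (-(Real.pi * |t| / 2))) *
      Real.exp (Real.pi * |t|) := by
    refine hn.symm.le.trans ?_
    gcongr
  calc Real.pi / C * (1 + |t|) ^ (σ - 1 / 2) * Real.exp (-(Real.pi * |t| / 2))
      = Real.pi * (C⁻¹ * (1 + |t|) ^ (σ - 1 / 2) * Real.exp (-(Real.pi * |t| / 2))) := by
        ring
    _ ≤ (X * (C * (1 + |t|) ^ (1 - σ - 1 / 2) * Real.exp (-(Real.pi * |t| / 2))) *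
      Real.exp (Real.pi * |t|)) * (C⁻¹ * (1 + |t|) ^ (σ - 1 / 2) *
        Real.exp (-(Real.pi * |t| / 2))) := by gcongr
    _ = X * (C * C⁻¹) * ((1 + |t|) ^ (1 - σ - 1 / 2) * (1 + |t|) ^ (σ - 1 / 2)) *
      (Real.exp (-(Real.pi * |t| / 2)) * Real.exp (-(Real.pi * |t| / 2)) *
        Real.exp (Real.pi * |t|)) := by ring
    _ = X := by rw [e2, e3, mul_inv_cancel₀ hC.ne']; ring

theorem exists_norm_mellin_le {f : ℝ → ℂ} {a b : ℝ} (ha : MellinConvergent f a)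
    (hb : MellinConvergent f b) :
    ∃ B : ℝ, ∀ s : ℂ, a ≤ s.re → s.re ≤ b → ‖mellin f s‖ ≤ B := by
  have key : ∀ c : ℝ, MellinConvergent f c →
      IntegrableOn (fun x : ℝ => x ^ (c - 1) * ‖f x‖) (Set.Ioi 0) := by
    intro c hc
    refine hc.norm.congr ?_
    filter_upwards [self_mem_ae_restrict measurableSet_Ioi] with x hx
    have hx' : (0 : ℝ) < x := hx
    simp only [norm_smul]
    rw [Complex.norm_cpow_eq_rpow_re_of_pos hx']
    simp
  refine ⟨∫ x in Set.Ioi (0 : ℝ), (x ^ (a - 1) * ‖f x‖ + x ^ (b - 1) * ‖f x‖),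
    fun s h1 h2 => ?_⟩
  refine norm_integral_le_of_norm_le ((key a ha).add (key b hb)) ?_
  filter_upwards [self_mem_ae_restrict measurableSet_Ioi] with x hx
  have hx' : (0 : ℝ) < x := hx
  rw [norm_smul, Complex.norm_cpow_eq_rpow_re_of_pos hx', ← add_mul]
  gcongr
  simp only [Complex.sub_re, Complex.one_re]
  rcases le_total x 1 with h | h
  · have := Real.rpow_le_rpow_of_exponent_ge hx' h (show a - 1 ≤ s.re - 1 by linarith)
    have := Real.rpow_nonneg hx'.le (b - 1)
    linarith
  · have := Real.rpow_le_rpow_of_exponent_le h (show s.re - 1 ≤ b - 1 by linarith)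
    have := Real.rpow_nonneg hx'.le (a - 1)
    linarith

theorem exists_norm_completedRiemannZeta₀_le (a b : ℝ) :
    ∃ B : ℝ, ∀ s : ℂ, a ≤ s.re → s.re ≤ b → ‖completedRiemannZeta₀ s‖ ≤ B := by
  have hP := (HurwitzZeta.hurwitzEvenFEPair 0).isStrongFEPair_toStrongFEPair
  obtain ⟨B, hB⟩ := exists_norm_mellin_le (a := a / 2) (b := b / 2)
    (hP.hasMellin ((a / 2 : ℝ) : ℂ)).1 (hP.hasMellin ((b / 2 : ℝ) : ℂ)).1
  refine ⟨B / 2, fun s h1 h2 => ?_⟩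
  have hs : (s / 2).re = s.re / 2 := by simp
  have h := hB (s / 2) (by rw [hs]; linarith) (by rw [hs]; linarith)
  have e : completedRiemannZeta₀ s =
      mellin (HurwitzZeta.hurwitzEvenFEPair 0).toStrongFEPair.f (s / 2) / 2 := rfl
  rw [e, norm_div]
  simpa using div_le_div_of_nonneg_right h (by norm_num : (0 : ℝ) ≤ 2)

theorem exists_norm_riemannZeta_le_two_div :
    ∃ δ₀ : ℝ, 0 < δ₀ ∧ ∀ δ : ℝ, 0 < δ → δ < δ₀ → ∀ s : ℂ, 1 + δ ≤ s.re →
      ‖riemannZeta s‖ ≤ 2 / δ := by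
  have h := riemannZeta_residue_one.norm
  rw [norm_one] at h
  have h2 := h.eventually (gt_mem_nhds (by norm_num : (1 : ℝ) < 2))
  rw [eventually_nhdsWithin_iff, Metric.eventually_nhds_iff] at h2
  obtain ⟨δ₀, hδ₀, hb⟩ := h2
  refine ⟨δ₀, hδ₀, fun δ hδ hlt s hs => ?_⟩
  have h3 := hb (y := ((1 + δ : ℝ) : ℂ)) (by
    rw [dist_eq_norm]
    have : ((1 + δ : ℝ) : ℂ) - 1 = (δ : ℂ) := by push_cast; ring
    rw [this, Complex.norm_real, Real.norm_eq_abs, abs_of_pos hδ]; exact hlt) (by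
      simp only [Set.mem_compl_iff, Set.mem_singleton_iff]
      intro h
      have := congrArg Complex.re h
      simp at this
      linarith)
  have e1 : ((1 + δ : ℝ) : ℂ) - 1 = (δ : ℂ) := by push_cast; ring
  rw [e1, norm_mul, Complex.norm_real, Real.norm_eq_abs, abs_of_pos hδ] at h3
  have h4 : ‖riemannZeta ((1 + δ : ℝ) : ℂ)‖ ≤ 2 / δ := by
    rw [le_div_iff₀ hδ]; linarith
  refine le_trans ?_ h4
  have hs1 : 1 < s.re := by linarith
  have hd1 : 1 < ((1 + δ : ℝ) : ℂ).re := by simp; exact hδ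
  have hn : ∀ (n : ℕ) (z : ℂ), ‖1 / ((n : ℂ) + 1) ^ z‖ = 1 / ((n : ℝ) + 1) ^ z.re := by
    intro n z
    rw [norm_div, norm_one]
    have : ((n : ℂ) + 1) = (((n : ℝ) + 1 : ℝ) : ℂ) := by push_cast; rfl
    rw [this, Complex.norm_cpow_eq_rpow_re_of_pos (by positivity)]
  have hsum : ∀ x : ℝ, 1 < x → Summable fun n : ℕ => 1 / ((n : ℝ) + 1) ^ x := by
    intro x hx
    have := (summable_nat_add_iff 1).2 (Real.summable_one_div_nat_rpow.2 hx)
    simpa using this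
  have e2 : riemannZeta ((1 + δ : ℝ) : ℂ) = ((∑' n : ℕ, 1 / ((n : ℝ) + 1) ^ (1 + δ) : ℝ) : ℂ) := by
    rw [zeta_eq_tsum_one_div_nat_add_one_cpow hd1, Complex.ofReal_tsum]
    refine tsum_congr fun n => ?_
    rw [Complex.ofReal_div, Complex.ofReal_cpow (by positivity)]
    push_cast; rfl
  rw [e2, Complex.norm_real, zeta_eq_tsum_one_div_nat_add_one_cpow hs1]
  have hsn : Summable fun n : ℕ => ‖1 / ((n : ℂ) + 1) ^ s‖ := by
    simp only [hn]; exact hsum _ hs1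
  refine (norm_tsum_le_tsum_norm hsn).trans ((Summable.tsum_le_tsum (fun n => ?_) hsn
    (hsum _ (by linarith))).trans (le_abs_self _))
  rw [hn]
  have : (1 : ℝ) ≤ (n : ℝ) + 1 := by linarith [(n.cast_nonneg : (0 : ℝ) ≤ n)]
  gcongr

theorem exists_norm_completedRiemannZeta_le :
    ∃ C : ℝ, 0 < C ∧ ∃ T₀ : ℝ, 4 ≤ T₀ ∧ ∀ T : ℝ, T₀ ≤ T → ∀ σ : ℝ, 0 ≤ σ →
      σ ≤ 1 + 1 / Real.log T →
      ‖completedRiemannZeta (σ + T * I)‖ ≤ C * Real.log T * Real.exp (-(Real.pi * T / 4)) := by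
  obtain ⟨Cg, hCg, hg⟩ := exists_norm_Gamma_le
  obtain ⟨δ₀, hδ₀, hz⟩ := exists_norm_riemannZeta_le_two_div
  obtain ⟨B, hB⟩ := exists_norm_completedRiemannZeta₀_le (-1 / 2) (3 / 2)
  refine ⟨3 * (Cg * 2 * Real.exp 1 * Real.exp 5), by positivity,
    max 8 (Real.exp (δ₀⁻¹ + 2)), le_trans (by norm_num) (le_max_left _ _), ?_⟩
  intro T hT σ hσ0 hσ1
  have hT8 : 8 ≤ T := (le_max_left _ _).trans hT
  have hTpos : 0 < T := by linarith
  have hlog : δ₀⁻¹ + 2 ≤ Real.log T := by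
    rw [Real.le_log_iff_exp_le hTpos]; exact (le_max_right _ _).trans hT
  have hδ0' : 0 < δ₀⁻¹ := by positivity
  set δ := 1 / Real.log T with hδdef
  have hlogpos : 0 < Real.log T := by linarith
  have hδ : 0 < δ := by positivity
  have hδlt : δ < δ₀ := by
    rw [hδdef, one_div, inv_lt_comm₀ hlogpos hδ₀]; linarith
  have hδhalf : δ ≤ 1 / 2 := by
    rw [hδdef]; exact one_div_le_one_div_of_le (by norm_num) (by linarith)
  set Q : ℂ → ℂ := fun s => (s * (s - 1) * completedRiemannZeta₀ s + 1) / (s + 2) ^ 2 with hQ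
  have hQΛ : ∀ s : ℂ, s ≠ 0 → s ≠ 1 → Q s = s * (s - 1) * completedRiemannZeta s / (s + 2) ^ 2 := by
    intro s h0 h1
    have h1' : (1 - s) ≠ 0 := sub_ne_zero.2 h1.symm
    simp only [hQ, completedRiemannZeta_eq]
    congr 1
    field_simp
    ring
  have hn1 : ∀ s : ℂ, -1 / 2 ≤ s.re → ‖s‖ ≤ ‖s + 2‖ ∧ ‖s - 1‖ ≤ ‖s + 2‖ ∧ 1 ≤ ‖s + 2‖ := by
    intro s hs
    refine ⟨?_, ?_, ?_⟩
    · refine abs_le_of_sq_le_sq' ?_ (norm_nonneg _) |>.2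
      rw [← Complex.normSq_eq_norm_sq, ← Complex.normSq_eq_norm_sq, Complex.normSq_apply,
        Complex.normSq_apply]
      simp; nlinarith
    · refine abs_le_of_sq_le_sq' ?_ (norm_nonneg _) |>.2
      rw [← Complex.normSq_eq_norm_sq, ← Complex.normSq_eq_norm_sq, Complex.normSq_apply,
        Complex.normSq_apply]
      simp; nlinarith
    · have := Complex.abs_re_le_norm (s + 2)
      have h2 := le_abs_self (s + 2).re
      simp at this h2
      linarith
  have hQle : ∀ s : ℂ, -1 / 2 ≤ s.re → s ≠ 0 → s ≠ 1 → ‖Q s‖ ≤ ‖completedRiemannZeta s‖ := by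
    intro s hs h0 h1
    obtain ⟨a1, a2, a3⟩ := hn1 s hs
    rw [hQΛ s h0 h1, norm_div, norm_mul, norm_mul, norm_pow, div_le_iff₀ (by positivity)]
    calc ‖s‖ * ‖s - 1‖ * ‖completedRiemannZeta s‖ ≤ ‖s + 2‖ * ‖s + 2‖ * ‖completedRiemannZeta s‖ := by
          gcongr
      _ = _ := by ring
  have hedge : ∀ (u : ℝ), ‖completedRiemannZeta (((1 + δ : ℝ) : ℂ) + u * I)‖ ≤
      Cg * (1 + |u|) ^ (δ / 2) * Real.exp (-(Real.pi * |u| / 4)) * (2 * Real.log T) := by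
    intro u
    set s : ℂ := ((1 + δ : ℝ) : ℂ) + u * I with hs
    have hsre : s.re = 1 + δ := by simp [hs]
    have hs0 : s ≠ 0 := by
      intro h; rw [h] at hsre; simp at hsre; linarith
    have hζ := hz δ hδ hδlt s hsre.ge
    have e1 : completedRiemannZeta s = riemannZeta s * Complex.Gammaℝ s := by
      rw [riemannZeta_def_of_ne_zero hs0, div_mul_cancel₀]
      exact Complex.Gammaℝ_ne_zero_of_re_pos (by rw [hsre]; linarith)
    have e2 : ‖Complex.Gammaℝ s‖ ≤ Cg * (1 + |u|) ^ (δ / 2) * Real.exp (-(Real.pi * |u| / 4)) := by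
      rw [Complex.Gammaℝ_def, norm_mul]
      have a1 : ‖(Real.pi : ℂ) ^ (-s / 2)‖ ≤ 1 := by
        rw [Complex.norm_cpow_eq_rpow_re_of_pos Real.pi_pos]
        apply Real.rpow_le_one_of_one_le_of_nonpos
        · linarith [Real.pi_gt_three]
        · simp [hsre]; linarith
      have a2 := hg ((1 + δ) / 2) (by linarith) (by linarith) (u / 2)
      have e3 : s / 2 = (((1 + δ) / 2 : ℝ) : ℂ) + ((u / 2 : ℝ) : ℂ) * I := by
        rw [hs]; push_cast; ring
      rw [e3]
      have a3 : |u / 2| = |u| / 2 := by rw [abs_div]; norm_num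
      have a4 : (1 + |u / 2|) ^ ((1 + δ) / 2 - 1 / 2) ≤ (1 + |u|) ^ (δ / 2) := by
        have : (1 + δ) / 2 - 1 / 2 = δ / 2 := by ring
        rw [this, a3]
        gcongr
        linarith [abs_nonneg u]
      have a5 : Real.pi * |u / 2| / 2 = Real.pi * |u| / 4 := by rw [a3]; ring
      rw [a5] at a2
      calc _ ≤ 1 * (Cg * (1 + |u / 2|) ^ ((1 + δ) / 2 - 1 / 2) *
            Real.exp (-(Real.pi * |u| / 4))) := by gcongr
        _ ≤ _ := by rw [one_mul]; gcongr
    rw [e1, norm_mul, mul_comm]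
    have : 2 / δ = 2 * Real.log T := by rw [hδdef]; field_simp
    rw [this] at hζ
    gcongr
  have hedge' : ∀ v : ℝ, Cg * (1 + |T + v|) ^ (δ / 2) * Real.exp (-(Real.pi * |T + v| / 4)) *
      (2 * Real.log T) * Real.exp (4 - v ^ 2) ≤
      Cg * 2 * Real.exp 1 * Real.exp 5 * Real.log T * Real.exp (-(Real.pi * T / 4)) := by
    intro v
    have a1 : (1 + |T + v|) ^ (δ / 2) ≤ Real.exp 1 * Real.exp |v| := by
      have b1 : 1 + |T + v| ≤ T ^ 2 * Real.exp |v| := by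
        have := abs_add_le T v
        rw [abs_of_pos hTpos] at this
        have h2 := Real.add_one_le_exp |v|
        have h3 : 1 + T ≤ T ^ 2 := by nlinarith
        have h4 : 1 ≤ T ^ 2 := by nlinarith
        nlinarith [abs_nonneg v]
      have b2 : (T ^ 2) ^ (δ / 2) = Real.exp 1 := by
        rw [← Real.rpow_natCast T 2, ← Real.rpow_mul hTpos.le, Real.rpow_def_of_pos hTpos]
        congr 1
        rw [hδdef]; push_cast; field_simp
      have b3 : Real.exp |v| ^ (δ / 2) ≤ Real.exp |v| := by
        rw [← Real.exp_mul]
        apply Real.exp_le_exp.2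
        nlinarith [abs_nonneg v]
      calc _ ≤ (T ^ 2 * Real.exp |v|) ^ (δ / 2) := by gcongr
        _ = (T ^ 2) ^ (δ / 2) * Real.exp |v| ^ (δ / 2) := Real.mul_rpow (by positivity) (by positivity)
        _ ≤ _ := by rw [b2]; gcongr
    have a2 : Real.exp (-(Real.pi * |T + v| / 4)) ≤ Real.exp (-(Real.pi * T / 4)) * Real.exp |v| := by
      rw [← Real.exp_add]
      apply Real.exp_le_exp.2
      have h1 : T ≤ |T + v| + |v| := by
        have := abs_sub (T + v) v
        simp only [add_sub_cancel_right] at this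
        exact (le_abs_self T).trans this
      nlinarith [Real.pi_pos, Real.pi_lt_four, abs_nonneg v, abs_nonneg (T + v)]
    have a3 : Real.exp |v| * Real.exp |v| * Real.exp (4 - v ^ 2) ≤ Real.exp 5 := by
      rw [← Real.exp_add, ← Real.exp_add]
      apply Real.exp_le_exp.2
      nlinarith [sq_nonneg (|v| - 1), sq_abs v]
    calc _ ≤ Cg * (Real.exp 1 * Real.exp |v|) * (Real.exp (-(Real.pi * T / 4)) * Real.exp |v|) *
          (2 * Real.log T) * Real.exp (4 - v ^ 2) := by gcongr
      _ = Cg * 2 * Real.exp 1 * Real.log T * Real.exp (-(Real.pi * T / 4)) *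
          (Real.exp |v| * Real.exp |v| * Real.exp (4 - v ^ 2)) := by ring
      _ ≤ Cg * 2 * Real.exp 1 * Real.log T * Real.exp (-(Real.pi * T / 4)) * Real.exp 5 := by gcongr
      _ = _ := by ring
  have key : ‖Q (σ + T * I) * Complex.exp ((σ : ℂ) ^ 2)‖ ≤
      Cg * 2 * Real.exp 1 * Real.exp 5 * Real.log T * Real.exp (-(Real.pi * T / 4)) := by
    refine norm_le_of_strip_of_bounded (f := fun w => Q (w + T * I) * Complex.exp (w ^ 2))
      (a := -δ) (b := 1 + δ) (B := (B + 1) * Real.exp 4) (by linarith)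
      ?_ ?_ ?_ ?_ (by simp; linarith) (by simpa using hσ1)
    · intro z h1 h2
      have hne : z + T * I + 2 ≠ 0 := by
        intro h
        have := congrArg Complex.re h
        simp at this
        linarith
      have hd : Differentiable ℂ completedRiemannZeta₀ := differentiable_completedZeta₀
      have hd' : DifferentiableAt ℂ Q (z + T * I) := by
        simp only [hQ]
        refine DifferentiableAt.div ?_ (by fun_prop) (pow_ne_zero _ hne)
        have := hd (z + T * I)
        fun_prop
      have : DifferentiableAt ℂ (fun w => Q (w + T * I)) z :=
        DifferentiableAt.comp z (f := fun w : ℂ => w + T * I) hd' (by fun_prop)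
      fun_prop
    · intro z h1 h2
      rw [norm_mul, norm_exp_sq]
      have hre : (z + T * I).re = z.re := by simp
      obtain ⟨a1, a2, a3⟩ := hn1 (z + T * I) (by rw [hre]; linarith)
      have a4 := hB (z + T * I) (by rw [hre]; linarith) (by rw [hre]; linarith)
      have a5 : ‖Q (z + T * I)‖ ≤ B + 1 := by
        simp only [hQ]
        rw [norm_div, norm_pow, div_le_iff₀ (by positivity)]
        refine (norm_add_le _ _).trans ?_
        rw [norm_mul, norm_mul, norm_one]
        set X := ‖z + T * I + 2‖
        have hB0 : 0 ≤ B := (norm_nonneg _).trans a4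
        calc _ ≤ X * X * B + X * X := by
              gcongr
              nlinarith
          _ = _ := by ring
      have hB1 : 0 ≤ B + 1 := (norm_nonneg _).trans a5
      gcongr
      nlinarith [sq_nonneg z.im]
    · intro z hz
      have e : z + T * I = 1 - (((1 + δ : ℝ) : ℂ) + ((-(T + z.im) : ℝ) : ℂ) * I) := by
        apply Complex.ext <;> simp [hz]
        ring
      have hre : (z + T * I).re = -δ := by simp [hz]
      rw [norm_mul, norm_exp_sq]
      have a1 := hQle (z + T * I) (by rw [hre]; linarith)
        (by intro h; rw [h] at hre; simp at hre; linarith)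
        (by intro h; rw [h] at hre; simp at hre; linarith)
      rw [e, completedRiemannZeta_one_sub, ← e] at a1
      have a2 := hedge (-(T + z.im))
      rw [abs_neg] at a2
      have a3 : Real.exp (z.re ^ 2 - z.im ^ 2) ≤ Real.exp (4 - z.im ^ 2) := by
        apply Real.exp_le_exp.2; rw [hz]; nlinarith
      refine le_trans ?_ (hedge' z.im)
      have := a1.trans a2
      gcongr
    · intro z hz
      have e : z + T * I = (((1 + δ : ℝ) : ℂ) + (((T + z.im) : ℝ) : ℂ) * I) := by
        apply Complex.ext <;> simp [hz]
        ring
      have hre : (z + T * I).re = 1 + δ := by simp [hz]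
      rw [norm_mul, norm_exp_sq]
      have a1 := hQle (z + T * I) (by rw [hre]; linarith)
        (by intro h; rw [h] at hre; simp at hre; linarith)
        (by intro h; rw [h] at hre; simp at hre; linarith)
      nth_rewrite 2 [e] at a1
      have a2 := hedge (T + z.im)
      have a3 : Real.exp (z.re ^ 2 - z.im ^ 2) ≤ Real.exp (4 - z.im ^ 2) := by
        apply Real.exp_le_exp.2; rw [hz]; nlinarith
      refine le_trans ?_ (hedge' z.im)
      have := a1.trans a2
      gcongr
  set s : ℂ := σ + T * I with hs
  have him : s.im = T := by simp [hs]
  have hre : s.re = σ := by simp [hs]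
  have hs0 : s ≠ 0 := by intro h; rw [h] at him; simp at him; linarith
  have hs1 : s ≠ 1 := by intro h; rw [h] at him; simp at him; linarith
  rw [norm_mul, norm_exp_sq, hQΛ s hs0 hs1, norm_div, norm_mul, norm_mul, norm_pow] at key
  have hsn : 8 ≤ ‖s‖ := by
    have := (le_abs_self _).trans (Complex.abs_im_le_norm s); rw [him] at this; linarith
  have hsn1 : 8 ≤ ‖s - 1‖ := by
    have := (le_abs_self _).trans (Complex.abs_im_le_norm (s - 1)); simp [him] at this; linarith
  have b1 : ‖s + 2‖ ≤ 3 / 2 * ‖s‖ := by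
    have := norm_add_le s 2; simp at this; linarith
  have b2 : ‖s + 2‖ ≤ 2 * ‖s - 1‖ := by
    have h := norm_add_le (s - 1) 3
    have e : s - 1 + 3 = s + 2 := by ring
    rw [e] at h; simp at h; linarith
  have b3 : 0 < ‖s + 2‖ := by
    have := (le_abs_self _).trans (Complex.abs_im_le_norm (s + 2)); simp [him] at this; linarith
  have b4 : 1 ≤ Real.exp ((σ : ℂ).re ^ 2 - (σ : ℂ).im ^ 2) := by
    apply Real.one_le_exp; simp; positivity
  set X := ‖completedRiemannZeta s‖
  have b5 : X ≤ 3 * (‖s‖ * ‖s - 1‖ * X / ‖s + 2‖ ^ 2) := by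
    rw [← mul_div_assoc, le_div_iff₀ (by positivity)]
    calc X * ‖s + 2‖ ^ 2 = X * (‖s + 2‖ * ‖s + 2‖) := by ring
      _ ≤ X * ((3 / 2 * ‖s‖) * (2 * ‖s - 1‖)) := by gcongr
      _ = _ := by ring
  calc X ≤ 3 * (‖s‖ * ‖s - 1‖ * X / ‖s + 2‖ ^ 2 * 1) := by rw [mul_one]; exact b5
    _ ≤ 3 * (‖s‖ * ‖s - 1‖ * X / ‖s + 2‖ ^ 2 *
        Real.exp ((σ : ℂ).re ^ 2 - (σ : ℂ).im ^ 2)) := by gcongr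
    _ ≤ 3 * _ := mul_le_mul_of_nonneg_left key (by norm_num)
    _ = _ := by ring

/-- The convexity bound for the Riemann zeta function. -/
theorem exists_norm_riemannZeta_le :
    ∃ C : ℝ, 0 < C ∧ ∃ T₀ : ℝ, 4 ≤ T₀ ∧ ∀ T : ℝ, T₀ ≤ T → ∀ σ : ℝ, 1 / 2 ≤ σ → σ ≤ 5 / 4 →
      ‖riemannZeta (σ + T * I)‖ ≤ C * Real.log T * T ^ (max 0 ((1 - σ) / 2)) := by
  obtain ⟨C, hC, T₀, hT₀, hΛ⟩ := exists_norm_completedRiemannZeta_le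
  obtain ⟨c, hc, hg⟩ := exists_le_norm_Gamma
  obtain ⟨δ₀, hδ₀, hz⟩ := exists_norm_riemannZeta_le_two_div
  refine ⟨max 2 (C * 4 / c), by positivity, max T₀ (Real.exp (δ₀⁻¹ + 2)),
    hT₀.trans (le_max_left _ _), ?_⟩
  intro T hT σ hσ0 hσ1
  have hT1 : T₀ ≤ T := (le_max_left _ _).trans hT
  have hTpos : 0 < T := by linarith
  have hlog : δ₀⁻¹ + 2 ≤ Real.log T := by
    rw [Real.le_log_iff_exp_le hTpos]; exact (le_max_right _ _).trans hT
  have hδ0' : 0 < δ₀⁻¹ := by positivity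
  have hlogpos : 0 < Real.log T := by linarith
  have hone : 1 ≤ T ^ (max 0 ((1 - σ) / 2)) :=
    Real.one_le_rpow (by linarith) (le_max_left _ _)
  rcases le_or_gt (1 + 1 / Real.log T) σ with h | h
  · have := hz (1 / Real.log T) (by positivity)
      (by rw [one_div, inv_lt_comm₀ hlogpos hδ₀]; linarith) (σ + T * I) (by simpa using h)
    calc _ ≤ 2 / (1 / Real.log T) := this
      _ = 2 * Real.log T * 1 := by field_simp
      _ ≤ _ := by
        gcongr
        exact le_max_left _ _
  · have h1 := hΛ T hT1 σ (by linarith) h.le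
    have h2 := hg (σ / 2) (by linarith) (by linarith) (T / 2)
    set s : ℂ := σ + T * I with hs
    have him : s.im = T := by simp [hs]
    have hre : s.re = σ := by simp [hs]
    have hs0 : s ≠ 0 := by intro h; rw [h] at him; simp at him; linarith
    have e3 : (((σ / 2 : ℝ) : ℂ) + ((T / 2 : ℝ) : ℂ) * I) = s / 2 := by rw [hs]; push_cast; ring
    rw [e3, abs_of_pos (by positivity : 0 < T / 2)] at h2
    have a1 : (1 : ℝ) / 4 ≤ ‖(Real.pi : ℂ) ^ (-s / 2)‖ := by
      rw [Complex.norm_cpow_eq_rpow_re_of_pos Real.pi_pos]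
      have : (-s / 2).re = -(σ / 2) := by simp [hre]; ring
      rw [this]
      calc (1 : ℝ) / 4 ≤ Real.pi⁻¹ := by
            rw [one_div]; exact inv_anti₀ Real.pi_pos Real.pi_lt_four.le
        _ = Real.pi ^ (-1 : ℝ) := (Real.rpow_neg_one _).symm
        _ ≤ _ := Real.rpow_le_rpow_of_exponent_le (by linarith [Real.pi_gt_three]) (by linarith)
    have a2 : T ^ (-(max 0 ((1 - σ) / 2))) ≤ (1 + T / 2) ^ (σ / 2 - 1 / 2) := by
      rcases le_total σ 1 with h' | h'
      · rw [max_eq_right (by linarith)]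
        have : σ / 2 - 1 / 2 = -((1 - σ) / 2) := by ring
        rw [this]
        exact Real.rpow_le_rpow_of_nonpos (by positivity) (by linarith) (by linarith)
      · rw [max_eq_left (by linarith), neg_zero, Real.rpow_zero]
        exact Real.one_le_rpow (by linarith) (by linarith)
    have hE : Real.exp (-(Real.pi * (T / 2) / 2)) = Real.exp (-(Real.pi * T / 4)) := by
      congr 1; ring
    rw [hE] at h2
    set E := Real.exp (-(Real.pi * T / 4))
    have hEpos : 0 < E := Real.exp_pos _
    set p := max 0 ((1 - σ) / 2)
    have hp : T ^ (-p) * T ^ p = 1 := by rw [← Real.rpow_add hTpos]; simp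
    have a3 : 1 / 4 * (c * T ^ (-p) * E) ≤ ‖Complex.Gammaℝ s‖ := by
      rw [Complex.Gammaℝ_def, norm_mul]
      have : c * T ^ (-p) * E ≤ ‖Complex.Gamma (s / 2)‖ := le_trans (by gcongr) h2
      gcongr
    have hGpos : 0 < ‖Complex.Gammaℝ s‖ := lt_of_lt_of_le (by positivity) a3
    rw [riemannZeta_def_of_ne_zero hs0, norm_div, div_le_iff₀ hGpos]
    calc _ ≤ C * Real.log T * E * 1 := by rw [mul_one]; exact h1
      _ = C * 4 / c * Real.log T * T ^ p * (1 / 4 * (c * T ^ (-p) * E)) := by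
          rw [show C * Real.log T * E * 1 = C * Real.log T * E * (T ^ (-p) * T ^ p) by rw [hp]]
          field_simp
      _ ≤ _ := by
        gcongr
        exact le_max_right _ _

/-- The integrand `Γ(s) z ^ (-s)` of the Mellin inversion formula for `exp (-z)`,
in terms of `w = log z`. -/
noncomputable def gammaExp (w s : ℂ) : ℂ := Complex.Gamma s * Complex.exp (-(s * w))

theorem norm_gammaExp (L θ σ t : ℝ) :
    ‖gammaExp (L + θ * I) (σ + t * I)‖ =
      ‖Complex.Gamma (σ + t * I)‖ * (Real.exp (-(σ * L)) * Real.exp (θ * t)) := by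
  rw [gammaExp, norm_mul, Complex.norm_exp, ← Real.exp_add]
  congr 2
  simp
  ring

theorem exists_norm_gammaExp_le :
    ∃ C : ℝ, 0 < C ∧ ∀ σ : ℝ, 1 / 4 ≤ σ → σ ≤ 5 / 2 → ∀ L θ t : ℝ,
      ‖gammaExp (L + θ * I) (σ + t * I)‖ ≤
        C * (1 + |t|) ^ (σ - 1 / 2) * Real.exp (-(σ * L)) *
          Real.exp (θ * t - Real.pi * |t| / 2) := by
  obtain ⟨C, hC, h⟩ := exists_norm_Gamma_le
  refine ⟨C, hC, fun σ h1 h2 L θ t => ?_⟩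
  rw [norm_gammaExp]
  calc _ ≤ (C * (1 + |t|) ^ (σ - 1 / 2) * Real.exp (-(Real.pi * |t| / 2))) *
        (Real.exp (-(σ * L)) * Real.exp (θ * t)) := by gcongr; exact h σ h1 h2 t
    _ = _ := by
      rw [sub_eq_add_neg (θ * t), Real.exp_add]; ring

theorem exp_mul_sub_le_one {θ : ℝ} (hθ : |θ| ≤ Real.pi / 2) (t : ℝ) :
    Real.exp (θ * t - Real.pi * |t| / 2) ≤ 1 := by
  rw [Real.exp_le_one_iff]
  have h1 : θ * t ≤ |θ| * |t| := by rw [← abs_mul]; exact le_abs_self _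
  nlinarith [abs_nonneg t]

theorem gammaExp_add_one {w s : ℂ} (hs : s ≠ 0) :
    gammaExp w (s + 1) = s * Complex.exp (-w) * gammaExp w s := by
  rw [gammaExp, gammaExp, Complex.Gamma_add_one s hs, add_mul, one_mul, neg_add, Complex.exp_add]
  ring

theorem differentiableAt_gammaExp {w s : ℂ} (hs : 0 < s.re) :
    DifferentiableAt ℂ (gammaExp w) s := by
  have h1 : DifferentiableAt ℂ Complex.Gamma s := by
    apply Complex.differentiableAt_Gamma
    intro m h
    rw [h] at hs
    simp at hs
    linarith [(m.cast_nonneg : (0 : ℝ) ≤ m)]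
  have h2 : DifferentiableAt ℂ (fun s => Complex.exp (-(s * w))) s := by fun_prop
  exact h1.mul h2

theorem riemannZeta_one_sub_eq_gammaExp {s : ℂ} (hs : 0 < s.re) (hs1 : s ≠ 1) :
    riemannZeta (1 - s) =
      (gammaExp ((Real.log (2 * Real.pi) : ℝ) + (Real.pi / 2 : ℝ) * I) s +
        gammaExp ((Real.log (2 * Real.pi) : ℝ) + (-(Real.pi / 2) : ℝ) * I) s) * riemannZeta s := by
  rw [riemannZeta_one_sub (fun n h => by
    rw [h] at hs; simp at hs; linarith [(n.cast_nonneg : (0 : ℝ) ≤ n)]) hs1]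
  have e1 : (2 * (Real.pi : ℂ)) ^ (-s) =
      Complex.exp (-(s * (Real.log (2 * Real.pi) : ℝ))) := by
    rw [Complex.cpow_def_of_ne_zero (by simp [Real.pi_ne_zero]), Complex.ofReal_log (by positivity)]
    congr 1
    push_cast
    ring
  have e2 : Complex.cos (Real.pi * s / 2) = (Complex.exp (-(s * (-(Real.pi / 2) : ℝ) * I)) +
      Complex.exp (-(s * (Real.pi / 2 : ℝ) * I))) / 2 := by
    rw [Complex.cos]
    congr 3 <;> (push_cast; ring)
  simp only [gammaExp]
  rw [e1, e2, mul_add s, mul_add s, neg_add, neg_add, Complex.exp_add, Complex.exp_add,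
    mul_assoc s, mul_assoc s]
  ring

theorem chi_mul_riemannZeta_one_sub {s : ℂ} (hs : s.re < 1) (hs0 : s ≠ 0) :
    chi s * riemannZeta (1 - s) = riemannZeta s := by
  have h := riemannZeta_one_sub (s := 1 - s) (fun n h => by
    have := congrArg Complex.re h
    simp at this; linarith [(n.cast_nonneg : (0 : ℝ) ≤ n)]) (by simpa using hs0)
  rw [sub_sub_cancel] at h
  rw [h, chi]
  have e1 : Complex.cos (Real.pi * (1 - s) / 2) = Complex.sin (Real.pi * s / 2) := by
    rw [← Complex.cos_pi_div_two_sub]; congr 1; ring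
  have e2 : (2 : ℂ) * (2 * Real.pi) ^ (-(1 - s)) = 2 ^ s * (Real.pi : ℂ) ^ (s - 1) := by
    have : (2 * (Real.pi : ℂ)) = ((2 : ℝ) : ℂ) * (Real.pi : ℝ) := by push_cast; rfl
    rw [neg_sub, this, Complex.mul_cpow_ofReal_nonneg (by norm_num) Real.pi_pos.le]
    rw [Complex.ofReal_ofNat, Complex.cpow_sub _ _ (by norm_num : (2 : ℂ) ≠ 0), Complex.cpow_one]
    field_simp
  rw [e1, ← e2]
  ring

theorem chi_half_add_ne_zero (t : ℝ) : chi (1 / 2 + I * t) ≠ 0 := by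
  rw [chi]
  refine mul_ne_zero (mul_ne_zero (mul_ne_zero ?_ ?_) ?_) ?_
  · simp [Complex.cpow_eq_zero_iff]
  · simp [Complex.cpow_eq_zero_iff, Real.pi_ne_zero]
  · rw [Ne, Complex.sin_eq_zero_iff]
    rintro ⟨k, hk⟩
    have h1 : (1 / 2 + I * t : ℂ) = 2 * k := by
      have := Complex.ofReal_ne_zero.2 Real.pi_ne_zero
      field_simp at hk ⊢
      linear_combination hk
    have h2 := congrArg Complex.re h1
    simp at h2
    have h3 : (1 : ℝ) = ((4 * k : ℤ) : ℝ) := by push_cast; linarith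
    have h4 : (1 : ℤ) = 4 * k := by exact_mod_cast h3
    omega
  · apply Complex.Gamma_ne_zero_of_re_pos
    simp
    norm_num

theorem Z_sq_mul_riemannZeta (t : ℝ) :
    (Z t) ^ 2 * riemannZeta (1 / 2 + I * t) =
      riemannZeta ((1 / 2 : ℝ) + t * I) ^ 2 * riemannZeta (1 - ((1 / 2 : ℝ) + t * I)) := by
  have e : (((1 / 2 : ℝ) : ℂ) + t * I) = 1 / 2 + I * t := by push_cast; ring
  rw [e, Z, mul_pow, ← Complex.cpow_nat_mul]
  have h := chi_mul_riemannZeta_one_sub (s := 1 / 2 + I * t) (by simp; norm_num) (by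
    intro h; have := congrArg Complex.re h; simp at this)
  have h0 := chi_half_add_ne_zero t
  have e2 : ((2 : ℕ) : ℂ) * -(1 / 2) = -1 := by norm_num
  rw [e2, Complex.cpow_neg_one]
  nth_rewrite 2 [← h]
  generalize (1 / 2 + I * t : ℂ) = s at h0 ⊢
  field_simp

/-- The function `ζ(s) ^ 2 ζ(1 - s)`. -/
noncomputable def zetaCube (s : ℂ) : ℂ := riemannZeta s ^ 2 * riemannZeta (1 - s)

theorem differentiableAt_zetaCube {s : ℂ} (hs : s ≠ 0) (hs1 : s ≠ 1) :
    DifferentiableAt ℂ zetaCube s := by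
  have h1 := differentiableAt_riemannZeta hs1
  have h2 : DifferentiableAt ℂ (fun s => riemannZeta (1 - s)) s := by
    have h3 : DifferentiableAt ℂ riemannZeta (1 - s) :=
      differentiableAt_riemannZeta (by simpa using hs)
    exact DifferentiableAt.comp s h3 (by fun_prop)
  exact (h1.pow 2).mul h2

theorem exists_norm_zetaCube_le :
    ∃ C : ℝ, 0 < C ∧ ∃ T₀ : ℝ, 4 ≤ T₀ ∧ ∀ T : ℝ, T₀ ≤ T → ∀ σ : ℝ, 1 / 2 ≤ σ → σ ≤ 5 / 4 →
      ‖zetaCube (σ + T * I)‖ ≤ C * (T ^ ((3 : ℝ) / 4) * Real.log T ^ 3) := by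
  obtain ⟨C, hC, T₀, hT₀, hz⟩ := exists_norm_riemannZeta_le
  obtain ⟨D, hD, hg⟩ := exists_norm_gammaExp_le
  refine ⟨C ^ 3 * (2 * (D * 2)), by positivity, T₀, hT₀, fun T hT σ h1 h2 => ?_⟩
  have hTpos : 0 < T := by linarith
  have hlog : 0 < Real.log T := Real.log_pos (by linarith)
  have hG : ∀ θ : ℝ, |θ| ≤ Real.pi / 2 →
      ‖gammaExp ((Real.log (2 * Real.pi) : ℝ) + θ * I) (σ + T * I)‖ ≤
        D * 2 * T ^ (σ - 1 / 2) := by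
    intro θ hθ
    have a1 : (1 + |T|) ^ (σ - 1 / 2) ≤ 2 * T ^ (σ - 1 / 2) := by
      calc (1 + |T|) ^ (σ - 1 / 2) ≤ (2 * T) ^ (σ - 1 / 2) := by
            rw [abs_of_pos hTpos]; gcongr; linarith
        _ = 2 ^ (σ - 1 / 2) * T ^ (σ - 1 / 2) := Real.mul_rpow (by norm_num) hTpos.le
        _ ≤ 2 ^ (1 : ℝ) * T ^ (σ - 1 / 2) := by gcongr <;> linarith
        _ = _ := by rw [Real.rpow_one]
    have a2 : Real.exp (-(σ * Real.log (2 * Real.pi))) ≤ 1 := by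
      rw [Real.exp_le_one_iff]
      have := Real.log_pos (show 1 < 2 * Real.pi by linarith [Real.pi_gt_three])
      nlinarith
    calc _ ≤ D * (1 + |T|) ^ (σ - 1 / 2) * Real.exp (-(σ * Real.log (2 * Real.pi))) *
          Real.exp (θ * T - Real.pi * |T| / 2) := hg σ (by linarith) (by linarith) _ θ T
      _ ≤ D * (2 * T ^ (σ - 1 / 2)) * 1 * 1 := by
          gcongr
          exact exp_mul_sub_le_one hθ T
      _ = _ := by ring
  have hp : |Real.pi / 2| ≤ Real.pi / 2 := (abs_of_pos (by positivity)).le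
  have hm : |-(Real.pi / 2)| ≤ Real.pi / 2 := by rwa [abs_neg]
  set p := max 0 ((1 - σ) / 2)
  have hexp : (T ^ p) ^ 3 * T ^ (σ - 1 / 2) ≤ T ^ ((3 : ℝ) / 4) := by
    rw [← Real.rpow_natCast, ← Real.rpow_mul hTpos.le, ← Real.rpow_add hTpos]
    apply Real.rpow_le_rpow_of_exponent_le (by linarith)
    rcases max_cases 0 ((1 - σ) / 2) with ⟨h, _⟩ | ⟨h, _⟩
    · simp only [p, h]; norm_num; linarith
    · simp only [p, h]; push_cast; linarith
  rw [zetaCube, riemannZeta_one_sub_eq_gammaExp (by simp; linarith) (by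
    intro h; have := congrArg Complex.im h; simp at this; linarith), norm_mul, norm_mul, norm_pow]
  have hzz := hz T hT σ h1 h2
  calc _ ≤ (C * Real.log T * T ^ p) ^ 2 *
        ((D * 2 * T ^ (σ - 1 / 2) + D * 2 * T ^ (σ - 1 / 2)) * (C * Real.log T * T ^ p)) := by
        gcongr
        exact (norm_add_le _ _).trans (add_le_add (hG _ hp) (hG _ hm))
    _ = C ^ 3 * (2 * (D * 2)) * (((T ^ p) ^ 3 * T ^ (σ - 1 / 2)) * Real.log T ^ 3) := by ring
    _ ≤ _ := by gcongr

theorem d3_eq_sum (n : ℕ) :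
    d3 n = ∑ x ∈ n.divisorsAntidiagonal, (x.2.divisorsAntidiagonal).card := by
  rw [← Finset.card_sigma, d3]
  refine Finset.card_bij' (fun p _ => ⟨(p.1, p.2.1 * p.2.2), p.2⟩)
    (fun x _ => (x.1.1, x.2.1, x.2.2)) ?_ ?_ ?_ ?_
  · rintro ⟨a, b, c⟩ h
    simp only [Finset.mem_filter, Finset.mem_product, Finset.mem_Icc] at h
    simp only [Finset.mem_sigma, Nat.mem_divisorsAntidiagonal]
    refine ⟨⟨by rw [← h.2, mul_assoc], by omega⟩, trivial, ?_⟩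
    exact Nat.mul_ne_zero (by omega) (by omega)
  · rintro ⟨⟨a, m⟩, b, c⟩ h
    simp only [Finset.mem_sigma, Nat.mem_divisorsAntidiagonal] at h
    obtain ⟨⟨h1, h0⟩, h2, h3⟩ := h
    have hn : a * b * c = n := by rw [mul_assoc, h2, h1]
    have hpos : 0 < a * b * c := by omega
    have ha : 0 < a := Nat.pos_of_ne_zero (by rintro rfl; simp at hpos)
    have hb : 0 < b := Nat.pos_of_ne_zero (by rintro rfl; simp at hpos)
    have hc : 0 < c := Nat.pos_of_ne_zero (by rintro rfl; simp at hpos)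
    simp only [Finset.mem_filter, Finset.mem_product, Finset.mem_Icc]
    have hn' : 0 < n := by omega
    refine ⟨⟨⟨ha, Nat.le_of_dvd hn' ⟨b * c, by rw [← hn, mul_assoc]⟩⟩,
      ⟨hb, Nat.le_of_dvd hn' ⟨a * c, by rw [← hn]; ring⟩⟩,
      ⟨hc, Nat.le_of_dvd hn' ⟨a * b, by rw [← hn]; ring⟩⟩⟩, hn⟩
  · rintro ⟨a, b, c⟩ h
    rfl
  · rintro ⟨⟨a, m⟩, b, c⟩ h
    simp only [Finset.mem_sigma, Nat.mem_divisorsAntidiagonal] at h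
    obtain ⟨⟨h1, h0⟩, h2, h3⟩ := h
    subst h2
    rfl

theorem natCast_d3_eq (n : ℕ) :
    (d3 n : ℂ) = (((ArithmeticFunction.zeta : ArithmeticFunction ℕ) : ArithmeticFunction ℂ) *
      (((ArithmeticFunction.zeta : ArithmeticFunction ℕ) : ArithmeticFunction ℂ) *
      ((ArithmeticFunction.zeta : ArithmeticFunction ℕ) : ArithmeticFunction ℂ))) n := by
  rw [ArithmeticFunction.mul_apply, d3_eq_sum, Nat.cast_sum]
  refine Finset.sum_congr rfl fun x hx => ?_
  obtain ⟨h1, h0⟩ := Nat.mem_divisorsAntidiagonal.1 hx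
  have hx1 : x.1 ≠ 0 := by rintro h; simp [h] at h1; omega
  rw [ArithmeticFunction.natCoe_apply, ArithmeticFunction.zeta_apply_ne hx1, Nat.cast_one, one_mul,
    ArithmeticFunction.mul_apply, Finset.card_eq_sum_ones, Nat.cast_sum]
  refine Finset.sum_congr rfl fun y hy => ?_
  obtain ⟨h1, h0⟩ := Nat.mem_divisorsAntidiagonal.1 hy
  have hy1 : y.1 ≠ 0 := by rintro h; simp [h] at h1; omega
  have hy2 : y.2 ≠ 0 := by rintro h; simp [h] at h1; omega
  simp [hy1, hy2]

theorem d3_zero : d3 0 = 0 := by simp [d3]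

theorem hasSum_d3 {s : ℂ} (hs : 1 < s.re) :
    HasSum (fun n : ℕ => (d3 n : ℂ) * Complex.exp (-(s * (Real.log n : ℝ)))) (riemannZeta s ^ 3) := by
  set Zf : ArithmeticFunction ℂ := ((ArithmeticFunction.zeta : ArithmeticFunction ℕ) :
    ArithmeticFunction ℂ) with hZ
  have h1 : LSeriesSummable (fun n => Zf n) s := by
    simpa [hZ] using ArithmeticFunction.LSeriesSummable_zeta_iff.2 hs
  have e1 : LSeries (fun n => Zf n) s = riemannZeta s := by
    simpa [hZ] using ArithmeticFunction.LSeries_zeta_eq_riemannZeta hs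
  have h2 := ArithmeticFunction.LSeriesSummable_mul h1 h1
  have e2 := ArithmeticFunction.LSeries_mul' h1 h1
  have h3 := ArithmeticFunction.LSeriesSummable_mul h1 h2
  have e3 := ArithmeticFunction.LSeries_mul' h1 h2
  have h4 : HasSum (LSeries.term _ s) _ := h3.LSeriesHasSum
  rw [e3, e2, e1] at h4
  have e5 : riemannZeta s ^ 3 = riemannZeta s * (riemannZeta s * riemannZeta s) := by ring
  rw [e5]
  convert h4 using 1
  funext n
  rcases eq_or_ne n 0 with rfl | hn
  · simp [d3_zero]
  · rw [LSeries.term_of_ne_zero hn, natCast_d3_eq, div_eq_mul_inv, ← Complex.cpow_neg,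
      Complex.cpow_def_of_ne_zero (by exact_mod_cast hn), Complex.ofReal_log (by positivity)]
    congr 2
    push_cast
    ring

theorem exists_card_divisors_pow_le (k : ℕ) :
    ∃ C : ℝ, 0 < C ∧ ∀ n : ℕ, n ≠ 0 → (n.divisors.card : ℝ) ^ k ≤ C * n := by
  obtain ⟨B, hB1, hB⟩ : ∃ B : ℝ, 1 ≤ B ∧ ∀ e : ℕ, ((e : ℝ) + 1) ^ k ≤ B * 2 ^ e := by
    have h := (tendsto_pow_const_div_const_pow_of_one_lt k (by norm_num : (1 : ℝ) < 2))
    have h' := h.comp (tendsto_add_atTop_nat 1)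
    obtain ⟨B, hB⟩ := h'.bddAbove_range
    refine ⟨max 1 (2 * B), le_max_left _ _, fun e => ?_⟩
    have := hB (Set.mem_range_self e)
    simp only [Function.comp_apply] at this
    rw [div_le_iff₀ (by positivity)] at this
    calc ((e : ℝ) + 1) ^ k ≤ B * 2 ^ (e + 1) := by exact_mod_cast this
      _ = 2 * B * 2 ^ e := by ring
      _ ≤ _ := by gcongr; exact le_max_right _ _
  refine ⟨B ^ (2 ^ k), by positivity, fun n hn => ?_⟩
  have hBpos : 0 < B := by linarith
  rw [Nat.card_divisors hn]
  have hnn : (n : ℝ) = ∏ p ∈ n.primeFactors, (p : ℝ) ^ (n.factorization p) := by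
    conv_lhs => rw [← Nat.prod_factorization_pow_eq_self hn]
    rw [Finsupp.prod, Nat.support_factorization]
    push_cast
    rfl
  have hpt : ∀ p ∈ n.primeFactors, ((n.factorization p : ℝ) + 1) ^ k ≤
      (if p < 2 ^ k then B else 1) * (p : ℝ) ^ (n.factorization p) := by
    intro p hp
    have hp2 : 2 ≤ p := (Nat.prime_of_mem_primeFactors hp).two_le
    set e := n.factorization p
    split_ifs with h
    · have : (2 : ℝ) ≤ p := by exact_mod_cast hp2
      exact (hB e).trans (by gcongr)
    · have h1 : ((2 : ℝ) ^ k) ≤ p := by exact_mod_cast not_lt.1 h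
      have h2 : (e : ℝ) + 1 ≤ 2 ^ e := by exact_mod_cast Nat.lt_two_pow_self
      rw [one_mul]
      calc ((e : ℝ) + 1) ^ k ≤ (2 ^ e) ^ k := by gcongr
        _ = (2 ^ k) ^ e := by rw [← pow_mul, ← pow_mul, mul_comm]
        _ ≤ _ := by gcongr
  have hc : ∏ p ∈ n.primeFactors, (if p < 2 ^ k then B else 1) ≤ B ^ (2 ^ k) := by
    rw [Finset.prod_ite, Finset.prod_const, Finset.prod_const_one, mul_one]
    apply pow_le_pow_right₀ hB1
    calc _ ≤ (Finset.range (2 ^ k)).card := by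
          apply Finset.card_le_card
          intro p hp
          simpa using (Finset.mem_filter.1 hp).2
      _ = _ := Finset.card_range _
  calc _ = ∏ p ∈ n.primeFactors, ((n.factorization p : ℝ) + 1) ^ k := by
        push_cast; rw [Finset.prod_pow]
    _ ≤ ∏ p ∈ n.primeFactors, ((if p < 2 ^ k then B else 1) * (p : ℝ) ^ (n.factorization p)) :=
        Finset.prod_le_prod (fun p _ => by positivity) hpt
    _ = (∏ p ∈ n.primeFactors, (if p < 2 ^ k then B else 1)) * n := by
        rw [Finset.prod_mul_distrib, ← hnn]
    _ ≤ _ := by gcongr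

theorem d3_le (n : ℕ) : d3 n ≤ n.divisors.card ^ 2 := by
  rw [d3_eq_sum, sq]
  have hc : ∀ m : ℕ, m.divisorsAntidiagonal.card = m.divisors.card := by
    intro m
    rw [← Nat.map_div_right_divisors, Finset.card_map]
  calc _ ≤ ∑ x ∈ n.divisorsAntidiagonal, n.divisors.card := by
        refine Finset.sum_le_sum fun x hx => ?_
        obtain ⟨h1, h0⟩ := Nat.mem_divisorsAntidiagonal.1 hx
        rw [hc]
        exact Finset.card_le_card (Nat.divisors_subset_of_dvd h0 ⟨x.1, by rw [← h1, mul_comm]⟩)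
    _ = _ := by rw [Finset.sum_const, hc, smul_eq_mul]

theorem exists_d3_le : ∃ C : ℝ, 0 < C ∧ ∀ n : ℕ, (d3 n : ℝ) ≤ C * (n : ℝ) ^ ((1 : ℝ) / 8) := by
  obtain ⟨C, hC, h⟩ := exists_card_divisors_pow_le 16
  refine ⟨C ^ ((1 : ℝ) / 8), by positivity, fun n => ?_⟩
  rcases eq_or_ne n 0 with rfl | hn
  · rw [d3_zero, Nat.cast_zero]; positivity
  rw [← Real.mul_rpow hC.le (by positivity), one_div, Real.le_rpow_inv_iff_of_pos (Nat.cast_nonneg _)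
    (by positivity) (by norm_num)]
  have h1 : (d3 n : ℝ) ≤ (n.divisors.card : ℝ) ^ 2 := by exact_mod_cast d3_le n
  calc (d3 n : ℝ) ^ (8 : ℝ) = (d3 n : ℝ) ^ 8 := by exact_mod_cast Real.rpow_natCast (d3 n : ℝ) 8
    _ ≤ ((n.divisors.card : ℝ) ^ 2) ^ 8 := by gcongr
    _ = (n.divisors.card : ℝ) ^ 16 := by ring
    _ ≤ _ := h n hn

theorem continuous_gammaExp_vertical (w : ℂ) {a : ℝ} (ha : 0 < a) :
    Continuous fun t : ℝ => gammaExp w (a + t * I) := by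
  rw [continuous_iff_continuousAt]
  intro t
  have h1 : ContinuousAt (gammaExp w) (a + t * I) :=
    (differentiableAt_gammaExp (by simpa using ha)).continuousAt
  have h2 : ContinuousAt (fun t : ℝ => (a + t * I : ℂ)) t := by fun_prop
  exact ContinuousAt.comp (f := fun t : ℝ => (a + t * I : ℂ)) h1 h2

/-- The integral of `gammaExp w` along a unit horizontal segment. -/
noncomputable def gammaExpEdge (w : ℂ) (a t : ℝ) : ℂ :=
  ∫ σ in a..(a + 1), gammaExp w (σ + t * I)

theorem gammaExpEdge_eq (w : ℂ) {a : ℝ} (ha : 0 < a) (t₁ t₂ : ℝ) :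
    gammaExpEdge w a t₂ = gammaExpEdge w a t₁ + I * ((∫ t in t₁..t₂, gammaExp w ((a + 1 : ℝ) + t * I)) -
      ∫ t in t₁..t₂, gammaExp w (a + t * I)) := by
  have h := Complex.integral_boundary_rect_eq_zero_of_differentiableOn (gammaExp w)
    (a + t₁ * I) ((a + 1 : ℝ) + t₂ * I) (by
      intro s hs
      apply DifferentiableAt.differentiableWithinAt
      apply differentiableAt_gammaExp
      have := hs.1
      simp at this
      linarith [this.1])
  simp only [Complex.add_re, Complex.ofReal_re, Complex.mul_re, Complex.I_re, mul_zero,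
    Complex.ofReal_im, Complex.I_im, mul_one, sub_self, add_zero, Complex.add_im,
    Complex.mul_im, zero_add, smul_eq_mul] at h
  rw [gammaExpEdge, gammaExpEdge]
  linear_combination -h

theorem hasDerivAt_gammaExpEdge (w : ℂ) {a : ℝ} (ha : 0 < a) (t : ℝ) :
    HasDerivAt (gammaExpEdge w a)
      (-I * ((1 - (a + t * I) * Complex.exp (-w)) * gammaExp w (a + t * I))) t := by
  have c1 := continuous_gammaExp_vertical w ha
  have c2 := continuous_gammaExp_vertical w (show 0 < a + 1 by linarith)
  have e : gammaExpEdge w a = fun x => gammaExpEdge w a 0 + I *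
      ((∫ t in (0 : ℝ)..x, gammaExp w ((a + 1 : ℝ) + t * I)) -
      ∫ t in (0 : ℝ)..x, gammaExp w (a + t * I)) := by
    funext x
    exact gammaExpEdge_eq w ha 0 x
  rw [e]
  have h1 := c1.integral_hasStrictDerivAt 0 t
  have h2 := c2.integral_hasStrictDerivAt 0 t
  have h3 := ((h2.hasDerivAt.sub h1.hasDerivAt).const_mul I).const_add (gammaExpEdge w a 0)
  refine h3.congr_deriv ?_
  have hs : (a + t * I : ℂ) ≠ 0 := by
    intro h; have := congrArg Complex.re h; simp at this; linarith
  have : (((a + 1 : ℝ) : ℂ) + t * I) = (a + t * I) + 1 := by push_cast; ring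
  rw [this, gammaExp_add_one hs]
  ring

/-- Integration by parts against the shift identity of `gammaExp`. -/
theorem norm_integral_gammaExp_le (w : ℂ) {a A B : ℝ} (ha : 0 < a) (hAB : A ≤ B)
    {D Φ φ h : ℝ → ℝ} (hD : ∀ t ∈ Set.Icc A B, 0 < D t)
    (hDle : ∀ t ∈ Set.Icc A B, D t ≤ ‖1 - (a + t * I) * Complex.exp (-w)‖)
    (hh : ∀ t ∈ Set.Icc A B, ‖gammaExpEdge w a t‖ ≤ h t)
    (hΦ : ∀ t ∈ Set.Icc A B, HasDerivAt Φ (φ t) t) (hφ : ContinuousOn φ (Set.Icc A B))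
    (hφle : ∀ t ∈ Set.Icc A B, h t * (Real.exp (-w.re) / D t ^ 2) ≤ φ t) :
    ‖∫ t in A..B, gammaExp w (a + t * I)‖ ≤ h B / D B + h A / D A + (Φ B - Φ A) := by
  set q : ℝ → ℂ := fun t => 1 - (a + t * I) * Complex.exp (-w) with hq
  have hq0 : ∀ t ∈ Set.Icc A B, q t ≠ 0 := fun t ht =>
    norm_pos_iff.1 ((hD t ht).trans_le (hDle t ht))
  have hqd : ∀ t : ℝ, HasDerivAt q (-(I * Complex.exp (-w))) t := by
    intro t
    have h1 : HasDerivAt (fun t : ℝ => (t : ℂ)) 1 t := Complex.ofRealCLM.hasDerivAt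
    have h2 := ((((h1.mul_const I).const_add (a : ℂ)).mul_const (Complex.exp (-w))).const_sub 1)
    refine h2.congr_deriv ?_
    ring
  have hu : ∀ t ∈ Set.uIcc A B, HasDerivAt (fun t => I * (q t)⁻¹)
      (-(Complex.exp (-w) / q t ^ 2)) t := by
    intro t ht
    rw [Set.uIcc_of_le hAB] at ht
    have := ((hqd t).inv (hq0 t ht)).const_mul I
    refine this.congr_deriv ?_
    linear_combination (Complex.exp (-w) / q t ^ 2) * Complex.I_sq
  have hH : ∀ t ∈ Set.uIcc A B, HasDerivAt (gammaExpEdge w a) (-I * (q t * gammaExp w (a + t * I))) t :=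
    fun t _ => hasDerivAt_gammaExpEdge w ha t
  have hqc : Continuous q := continuous_iff_continuousAt.2 fun t => (hqd t).continuousAt
  have hgc := continuous_gammaExp_vertical w ha
  have hu'c : ContinuousOn (fun t => -(Complex.exp (-w) / q t ^ 2)) (Set.Icc A B) :=
    (continuousOn_const.div (hqc.continuousOn.pow 2) fun t ht => pow_ne_zero 2 (hq0 t ht)).neg
  have hi := intervalIntegral.integral_mul_deriv_eq_deriv_mul hu hH
    (by apply ContinuousOn.intervalIntegrable; rwa [Set.uIcc_of_le hAB])
    (by apply Continuous.intervalIntegrable; fun_prop)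
  have e1 : ∫ t in A..B, I * (q t)⁻¹ * (-I * (q t * gammaExp w (a + t * I))) =
      ∫ t in A..B, gammaExp w (a + t * I) := by
    apply intervalIntegral.integral_congr
    intro t ht
    rw [Set.uIcc_of_le hAB] at ht
    have := hq0 t ht
    simp only
    generalize gammaExp w (a + t * I) = g
    field_simp
    linear_combination (-g) * Complex.I_sq
  rw [e1] at hi
  have hbd : ∀ t ∈ Set.Icc A B, ‖I * (q t)⁻¹ * gammaExpEdge w a t‖ ≤ h t / D t := by
    intro t ht
    rw [norm_mul, norm_mul, Complex.norm_I, one_mul, norm_inv, mul_comm, ← div_eq_mul_inv]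
    have h0 : 0 ≤ h t := (norm_nonneg _).trans (hh t ht)
    exact div_le_div₀ h0 (hh t ht) (hD t ht) (hDle t ht)
  have hf_int : ‖∫ t in A..B, -(Complex.exp (-w) / q t ^ 2) * gammaExpEdge w a t‖ ≤ Φ B - Φ A := by
    rw [← intervalIntegral.integral_eq_sub_of_hasDerivAt (f := Φ) (f' := φ)
      (by rwa [Set.uIcc_of_le hAB])
      (by apply ContinuousOn.intervalIntegrable; rwa [Set.uIcc_of_le hAB])]
    refine intervalIntegral.norm_integral_le_of_norm_le hAB ?_
      (by apply ContinuousOn.intervalIntegrable; rwa [Set.uIcc_of_le hAB])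
    refine Eventually.of_forall fun t ht => ?_
    have ht' : t ∈ Set.Icc A B := Set.Ioc_subset_Icc_self ht
    refine le_trans ?_ (hφle t ht')
    rw [norm_mul, norm_neg, norm_div, norm_pow, Complex.norm_exp, Complex.neg_re, mul_comm]
    have h0 : 0 ≤ h t := (norm_nonneg _).trans (hh t ht')
    have := hD t ht'
    have := hDle t ht'
    have := hh t ht'
    gcongr
  rw [hi]
  refine (norm_sub_le _ _).trans (add_le_add ((norm_sub_le _ _).trans (add_le_add ?_ ?_)) hf_int)
  · exact hbd B (Set.right_mem_Icc.2 hAB)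
  · exact hbd A (Set.left_mem_Icc.2 hAB)

theorem integrable_exp_neg_mul_abs' {b : ℝ} (hb : 0 < b) :
    Integrable fun t : ℝ => Real.exp (-(b * |t|)) := by
  rw [← integrableOn_univ, ← Set.Iic_union_Ioi (a := (0 : ℝ))]
  refine IntegrableOn.union ?_ ?_
  · refine (integrableOn_exp_mul_Iic hb 0).congr_fun (fun t ht => ?_) measurableSet_Iic
    simp only
    rw [abs_of_nonpos ht]; congr 1; ring
  · refine (integrableOn_exp_mul_Ioi (neg_neg_of_pos hb) 0).congr_fun (fun t ht => ?_)
      measurableSet_Ioi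
    simp only
    rw [abs_of_pos ht]; congr 1; ring

theorem exists_norm_gammaExp_quarter_le :
    ∃ C : ℝ, 0 < C ∧ ∀ (w : ℂ) (t : ℝ),
      ‖gammaExp w ((1 / 4 : ℝ) + t * I)‖ ≤
        C * Real.exp (-(w.re / 4)) * Real.exp (-((Real.pi / 2 - |w.im|) * |t|)) := by
  obtain ⟨C, hC, h⟩ := exists_norm_gammaExp_le
  refine ⟨C, hC, fun w t => ?_⟩
  have h1 := h (1 / 4) le_rfl (by norm_num) w.re w.im t
  rw [Complex.re_add_im] at h1
  refine h1.trans ?_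
  have h2 : (1 + |t|) ^ ((1 / 4 : ℝ) - 1 / 2) ≤ 1 :=
    Real.rpow_le_one_of_one_le_of_nonpos (by linarith [abs_nonneg t]) (by norm_num)
  have h3 : w.im * t - Real.pi * |t| / 2 ≤ -((Real.pi / 2 - |w.im|) * |t|) := by
    have : w.im * t ≤ |w.im| * |t| := by rw [← abs_mul]; exact le_abs_self _
    linarith
  calc _ ≤ C * 1 * Real.exp (-(1 / 4 * w.re)) *
        Real.exp (-((Real.pi / 2 - |w.im|) * |t|)) := by gcongr
    _ = _ := by rw [mul_one]; congr 3; ring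

theorem integrable_gammaExp_quarter {w : ℂ} (hw : |w.im| < Real.pi / 2) :
    Integrable fun t : ℝ => gammaExp w ((1 / 4 : ℝ) + t * I) := by
  obtain ⟨C, hC, h⟩ := exists_norm_gammaExp_quarter_le
  refine Integrable.mono' ((integrable_exp_neg_mul_abs' (sub_pos.2 hw)).const_mul
    (C * Real.exp (-(w.re / 4))))
    (continuous_gammaExp_vertical w (by norm_num)).aestronglyMeasurable
    (Eventually.of_forall fun t => h w t)

theorem differentiableAt_integral_gammaExp {w : ℂ} (hw : |w.im| < Real.pi / 2) :
    DifferentiableAt ℂ (fun w => ∫ t : ℝ, gammaExp w ((1 / 4 : ℝ) + t * I)) w := by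
  obtain ⟨C, hC, h⟩ := exists_norm_gammaExp_quarter_le
  set δ := (Real.pi / 2 - |w.im|) / 2 with hδ
  have hδ0 : 0 < δ := by rw [hδ]; linarith
  have key := hasDerivAt_integral_of_dominated_loc_of_deriv_le (𝕜 := ℂ) (μ := volume)
    (F := fun w (t : ℝ) => gammaExp w ((1 / 4 : ℝ) + t * I))
    (F' := fun w (t : ℝ) => -((1 / 4 : ℝ) + t * I) * gammaExp w ((1 / 4 : ℝ) + t * I))
    (x₀ := w) (s := Metric.ball w δ)
    (bound := fun t => (1 + 2 / δ) * (C * Real.exp ((|w.re| + δ) / 4)) *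
      Real.exp (-(δ / 2 * |t|)))
    (Metric.ball_mem_nhds w hδ0)
    (Eventually.of_forall fun w =>
      (continuous_gammaExp_vertical w (by norm_num)).aestronglyMeasurable)
    (integrable_gammaExp_quarter hw)
    (Continuous.aestronglyMeasurable (by
      have := continuous_gammaExp_vertical w (a := 1 / 4) (by norm_num)
      fun_prop)) ?_
    ((integrable_exp_neg_mul_abs' (half_pos hδ0)).const_mul _) ?_
  · exact key.2.differentiableAt
  · refine Eventually.of_forall fun t v hv => ?_
    rw [Metric.mem_ball, dist_eq_norm] at hv
    have h1 : |v.im| ≤ |w.im| + δ := by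
      have a1 := (Complex.abs_im_le_norm (v - w)).trans hv.le
      have a2 := abs_sub_abs_le_abs_sub v.im w.im
      rw [Complex.sub_im] at a1
      linarith
    have h2 : -v.re ≤ |w.re| + δ := by
      have a1 := (Complex.abs_re_le_norm (v - w)).trans hv.le
      rw [Complex.sub_re] at a1
      have := neg_le_of_abs_le a1
      have := neg_abs_le w.re
      linarith
    have h3 : ‖-((((1 / 4 : ℝ) : ℂ)) + t * I)‖ ≤ (1 + 2 / δ) * Real.exp (δ / 2 * |t|) := by
      rw [norm_neg]
      have a1 : ‖((((1 / 4 : ℝ) : ℂ)) + t * I)‖ ≤ 1 + |t| := by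
        refine (norm_add_le _ _).trans ?_
        rw [norm_mul, Complex.norm_I, Complex.norm_real, Complex.norm_real, mul_one]
        simp only [Real.norm_eq_abs]
        rw [abs_of_pos (by norm_num : (0 : ℝ) < 1 / 4)]
        linarith
      have a2 := Real.add_one_le_exp (δ / 2 * |t|)
      have a3 : 1 + |t| ≤ (1 + 2 / δ) * (δ / 2 * |t| + 1) := by
        have : (1 + 2 / δ) * (δ / 2 * |t| + 1) = 1 + |t| + (δ / 2 * |t| + 2 / δ) := by
          field_simp; ring
        rw [this]
        have : 0 ≤ δ / 2 * |t| + 2 / δ := by positivity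
        linarith
      refine a1.trans (a3.trans ?_)
      gcongr
    have h4 := h v t
    have h5 : Real.exp (-((Real.pi / 2 - |v.im|) * |t|)) ≤ Real.exp (-(δ * |t|)) := by
      apply Real.exp_le_exp.2
      have : δ ≤ Real.pi / 2 - |v.im| := by rw [hδ] at h1 ⊢; linarith
      have := mul_le_mul_of_nonneg_right this (abs_nonneg t)
      linarith
    rw [norm_mul]
    calc _ ≤ ((1 + 2 / δ) * Real.exp (δ / 2 * |t|)) *
          (C * Real.exp (-(v.re / 4)) * Real.exp (-((Real.pi / 2 - |v.im|) * |t|))) := by gcongr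
      _ ≤ ((1 + 2 / δ) * Real.exp (δ / 2 * |t|)) *
          (C * Real.exp ((|w.re| + δ) / 4) * Real.exp (-(δ * |t|))) := by
          gcongr
          linarith
      _ = (1 + 2 / δ) * (C * Real.exp ((|w.re| + δ) / 4)) *
          (Real.exp (δ / 2 * |t|) * Real.exp (-(δ * |t|))) := by ring
      _ = _ := by rw [← Real.exp_add]; congr 2; ring
  · refine Eventually.of_forall fun t v hv => ?_
    have h1 : HasDerivAt (fun v : ℂ => -(((1 / 4 : ℝ) + t * I) * v)) (-((1 / 4 : ℝ) + t * I)) v := by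
      refine (((hasDerivAt_id v).const_mul (((1 / 4 : ℝ) : ℂ) + t * I)).neg).congr_deriv ?_
      rw [mul_one]
    have h2 := (h1.cexp).const_mul (Complex.Gamma ((1 / 4 : ℝ) + t * I))
    refine h2.congr_deriv ?_
    simp only [gammaExp]
    ring

theorem integral_gammaExp_ofReal (L : ℝ) :
    ∫ t : ℝ, gammaExp L ((1 / 4 : ℝ) + t * I) = 2 * Real.pi * Complex.exp (-Complex.exp L) := by
  set f : ℝ → ℂ := fun x => Complex.exp (-(x : ℂ)) with hf
  have hm : ∀ s : ℂ, 0 < s.re → mellin f s = Complex.Gamma s := by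
    intro s hs
    rw [Complex.Gamma_eq_integral hs, Complex.GammaIntegral, mellin]
    refine setIntegral_congr_fun measurableSet_Ioi fun x hx => ?_
    simp only [hf, smul_eq_mul]
    push_cast
    ring
  have hre : ∀ t : ℝ, 0 < (((1 / 4 : ℝ) : ℂ) + t * I).re := by intro t; simp
  have hi := integrable_gammaExp_quarter (w := 0) (by simp; positivity)
  have h := mellinInv_mellin_eq (1 / 4) f (Real.exp_pos L)
    (by
      have := Complex.GammaIntegral_convergent (s := ((1 / 4 : ℝ) : ℂ)) (by simp)
      refine this.congr_fun (fun x hx => ?_) measurableSet_Ioi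
      simp only [hf, smul_eq_mul]
      push_cast
      ring)
    (by
      refine hi.congr (Eventually.of_forall fun t => ?_)
      simp only [gammaExp, mul_zero, neg_zero, Complex.exp_zero, mul_one]
      rw [hm _ (hre t)])
    (by fun_prop)
  rw [mellinInv] at h
  have e : ∫ y : ℝ, ((Real.exp L : ℝ) : ℂ) ^ (-(((1 / 4 : ℝ) : ℂ) + y * I)) •
      mellin f (((1 / 4 : ℝ) : ℂ) + y * I) = ∫ t : ℝ, gammaExp L ((1 / 4 : ℝ) + t * I) := by
    congr 1
    funext t
    rw [hm _ (hre t), gammaExp, Complex.cpow_def_of_ne_zero (by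
      exact_mod_cast (Real.exp_pos L).ne'), ← Complex.ofReal_log (Real.exp_pos L).le, Real.log_exp,
      smul_eq_mul, mul_comm]
    congr 2
    ring
  rw [e] at h
  simp only [hf, Complex.ofReal_exp] at h
  rw [← h, Complex.real_smul]
  generalize ∫ t : ℝ, gammaExp L ((1 / 4 : ℝ) + t * I) = J
  have := Complex.ofReal_ne_zero.2 Real.pi_ne_zero
  push_cast
  field_simp

/-- Mellin inversion for `exp (-z)` with `z = exp w` in the right half plane. -/
theorem integral_gammaExp {w : ℂ} (hw : |w.im| < Real.pi / 2) :
    ∫ t : ℝ, gammaExp w ((1 / 4 : ℝ) + t * I) = 2 * Real.pi * Complex.exp (-Complex.exp w) := by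
  set U : Set ℂ := {w | |w.im| < Real.pi / 2} with hU
  have hUo : IsOpen U := isOpen_lt (by fun_prop) continuous_const
  have hUc : IsPreconnected U := by
    have : U = Complex.imLm ⁻¹' (Set.Ioo (-(Real.pi / 2)) (Real.pi / 2)) := by
      ext w; simp [hU, abs_lt]
    rw [this]
    exact ((convex_Ioo _ _).linear_preimage Complex.imLm).isPreconnected
  have hf : AnalyticOnNhd ℂ (fun w => ∫ t : ℝ, gammaExp w ((1 / 4 : ℝ) + t * I)) U :=
    DifferentiableOn.analyticOnNhd
      (fun w hw => (differentiableAt_integral_gammaExp hw).differentiableWithinAt) hUo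
  have hg : AnalyticOnNhd ℂ (fun w => 2 * Real.pi * Complex.exp (-Complex.exp w)) U :=
    DifferentiableOn.analyticOnNhd (by fun_prop) hUo
  have h0 : (0 : ℂ) ∈ U := by simp [hU]; positivity
  refine hf.eqOn_of_preconnected_of_frequently_eq hg hUc h0 ?_ hw
  have ht : Tendsto (fun n : ℕ => (((1 : ℝ) / ((n : ℝ) + 1) : ℝ) : ℂ)) atTop (nhdsWithin 0 {0}ᶜ) := by
    rw [tendsto_nhdsWithin_iff]
    constructor
    · have := (Complex.continuous_ofReal.tendsto 0).comp
        (tendsto_one_div_add_atTop_nhds_zero_nat (𝕜 := ℝ))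
      rw [Complex.ofReal_zero] at this
      exact this
    · refine Eventually.of_forall fun n => ?_
      simp only [Set.mem_compl_iff, Set.mem_singleton_iff, Complex.ofReal_eq_zero]
      positivity
  exact ht.frequently (Eventually.of_forall fun n => integral_gammaExp_ofReal _).frequently

theorem exp_neg_mul_log {N : ℝ} (hN : 0 < N) (σ : ℝ) :
    Real.exp (-(σ * Real.log N)) = N ^ (-σ) := by
  rw [Real.rpow_def_of_pos hN]; congr 1; ring

theorem exists_norm_gammaExp_le_of_le :
    ∃ C : ℝ, 0 < C ∧ ∀ σ : ℝ, 1 / 4 ≤ σ → σ ≤ 5 / 2 → ∀ L θ t T : ℝ, 0 ≤ θ → θ ≤ Real.pi / 2 →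
      0 ≤ T → t ≤ T → ‖gammaExp (L + θ * I) (σ + t * I)‖ ≤
        C * (1 + T) ^ 2 * Real.exp (-(σ * L)) * Real.exp (t / 2) := by
  obtain ⟨C, hC, h⟩ := exists_norm_gammaExp_le
  refine ⟨4 * C, by positivity, fun σ h1 h2 L θ t T hθ hθ' hT ht => (h σ h1 h2 L θ t).trans ?_⟩
  have key : (1 + |t|) ^ (σ - 1 / 2) * Real.exp (θ * t - Real.pi * |t| / 2) ≤
      4 * (1 + T) ^ 2 * Real.exp (t / 2) := by
    have hb : (1 + |t|) ^ (σ - 1 / 2) ≤ (1 + |t|) ^ 2 := by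
      rw [← Real.rpow_two]
      exact Real.rpow_le_rpow_of_exponent_le (by linarith [abs_nonneg t]) (by linarith)
    rcases le_total 0 t with h0 | h0
    · have e1 := exp_mul_sub_le_one (θ := θ) (by rwa [abs_of_nonneg hθ]) t
      have e2 : (1 + |t|) ^ 2 ≤ 4 * (1 + T) ^ 2 := by
        rw [abs_of_nonneg h0]; nlinarith
      have e3 : 1 ≤ Real.exp (t / 2) := Real.one_le_exp (by linarith)
      exact mul_le_mul (hb.trans e2) (e1.trans e3) (Real.exp_nonneg _) (by positivity)
    · have e1 : (1 + |t|) ^ 2 ≤ 4 * Real.exp (-t) := by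
        rw [abs_of_nonpos h0]
        have : -t / 2 + 1 ≤ Real.exp (-t / 2) := Real.add_one_le_exp _
        have e : Real.exp (-t) = Real.exp (-t / 2) ^ 2 := by
          rw [sq, ← Real.exp_add]; congr 1; ring
        rw [e]
        nlinarith
      have e2 : Real.exp (θ * t - Real.pi * |t| / 2) ≤ Real.exp (3 / 2 * t) := by
        apply Real.exp_le_exp.2
        rw [abs_of_nonpos h0]
        nlinarith [Real.pi_gt_three]
      calc _ ≤ 4 * Real.exp (-t) * Real.exp (3 / 2 * t) := by
            refine mul_le_mul (hb.trans e1) e2 (Real.exp_nonneg _) (by positivity)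
        _ = 4 * Real.exp (t / 2) := by
            rw [mul_assoc, ← Real.exp_add]; congr 2; ring
        _ ≤ _ := by
            have : 1 ≤ (1 + T) ^ 2 := by nlinarith
            have := Real.exp_pos (t / 2)
            nlinarith
  have := mul_le_mul_of_nonneg_left key (show 0 ≤ C * Real.exp (-(σ * L)) by positivity)
  calc _ = C * Real.exp (-(σ * L)) * ((1 + |t|) ^ (σ - 1 / 2) *
      Real.exp (θ * t - Real.pi * |t| / 2)) := by ring
    _ ≤ _ := this
    _ = _ := by ring

theorem integrableOn_exp_half_Iic (T : ℝ) :
    IntegrableOn (fun t : ℝ => Real.exp (t / 2)) (Set.Iic T) := by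
  have := integrableOn_exp_mul_Iic (a := 1 / 2) (by norm_num) T
  refine this.congr_fun (fun t _ => ?_) measurableSet_Iic
  simp only
  congr 1; ring

theorem integrableOn_gammaExp_Iic {σ : ℝ} (h1 : 1 / 4 ≤ σ) (h2 : σ ≤ 5 / 2) (L : ℝ) {θ : ℝ}
    (hθ : 0 ≤ θ) (hθ' : θ ≤ Real.pi / 2) (T : ℝ) :
    IntegrableOn (fun t : ℝ => gammaExp (L + θ * I) (σ + t * I)) (Set.Iic T) := by
  obtain ⟨C, hC, h⟩ := exists_norm_gammaExp_le_of_le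
  refine Integrable.mono' ((integrableOn_exp_half_Iic T).const_mul
    (C * (1 + |T|) ^ 2 * Real.exp (-(σ * L))))
    (continuous_gammaExp_vertical _ (by linarith)).aestronglyMeasurable ?_
  refine (ae_restrict_iff' measurableSet_Iic).2 (Eventually.of_forall fun t ht => ?_)
  exact h σ h1 h2 L θ t |T| hθ hθ' (abs_nonneg _) (le_trans ht (le_abs_self _))

theorem exists_norm_gammaExpEdge_quarter_le_exp :
    ∃ C : ℝ, 0 < C ∧ ∀ L t : ℝ, 0 ≤ L → t ≤ 0 →
      ‖gammaExpEdge (L + (Real.pi / 2 : ℝ) * I) (1 / 4) t‖ ≤ C * Real.exp (t / 2) := by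
  obtain ⟨C, hC, h⟩ := exists_norm_gammaExp_le_of_le
  refine ⟨C, hC, fun L t hL ht => ?_⟩
  have := intervalIntegral.norm_integral_le_of_norm_le_const (a := 1 / 4) (b := 1 / 4 + 1)
    (C := C * Real.exp (t / 2))
    (f := fun σ : ℝ => gammaExp (L + (Real.pi / 2 : ℝ) * I) (σ + t * I)) (by
      intro σ hσ
      rw [Set.uIoc_of_le (by norm_num)] at hσ
      have hσ1 := hσ.1
      have hσ2 := hσ.2
      refine (h σ (by linarith) (by linarith) L (Real.pi / 2) t 0 (by positivity) le_rfl
        le_rfl ht).trans ?_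
      have : Real.exp (-(σ * L)) ≤ 1 := by
        rw [Real.exp_le_one_iff]
        have : 0 ≤ σ * L := by apply mul_nonneg <;> linarith
        linarith
      have h5 := Real.exp_pos (t / 2)
      calc C * (1 + 0) ^ 2 * Real.exp (-(σ * L)) * Real.exp (t / 2)
          ≤ C * (1 + 0) ^ 2 * 1 * Real.exp (t / 2) := by gcongr
        _ = _ := by ring)
  simpa [gammaExpEdge] using this

theorem exists_norm_gammaExpEdge_quarter_le :
    ∃ C : ℝ, 0 < C ∧ ∀ N θ t : ℝ, 0 < N → |θ| ≤ Real.pi / 2 → 0 ≤ t → N ≤ 1 + t →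
      ‖gammaExpEdge ((Real.log N : ℝ) + θ * I) (1 / 4) t‖ ≤
        C * ((1 + t) ^ ((3 : ℝ) / 4) * N ^ (-(5 / 4) : ℝ)) := by
  obtain ⟨C, hC, h⟩ := exists_norm_gammaExp_le
  refine ⟨C, hC, fun N θ t hN hθ ht hNt => ?_⟩
  have := intervalIntegral.norm_integral_le_of_norm_le_const (a := 1 / 4) (b := 1 / 4 + 1)
    (C := C * ((1 + t) ^ ((3 : ℝ) / 4) * N ^ (-(5 / 4) : ℝ)))
    (f := fun σ : ℝ => gammaExp ((Real.log N : ℝ) + θ * I) (σ + t * I)) (by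
      intro σ hσ
      rw [Set.uIoc_of_le (by norm_num)] at hσ
      have hσ1 := hσ.1
      have hσ2 := hσ.2
      refine (h σ (by linarith) (by linarith) (Real.log N) θ t).trans ?_
      rw [exp_neg_mul_log hN, abs_of_nonneg ht]
      have e1 := exp_mul_sub_le_one hθ t
      rw [abs_of_nonneg ht] at e1
      have ht1 : 0 < 1 + t := by linarith
      have e2 : N ^ (-σ) ≤ N ^ (-(5 / 4) : ℝ) * (1 + t) ^ (5 / 4 - σ) := by
        have : N ^ (-σ) = N ^ (-(5 / 4) : ℝ) * N ^ (5 / 4 - σ) := by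
          rw [← Real.rpow_add hN]; congr 1; ring
        rw [this]
        gcongr
        linarith
      have e3 : (1 + t) ^ ((3 : ℝ) / 4) = (1 + t) ^ (σ - 1 / 2) * (1 + t) ^ (5 / 4 - σ) := by
        rw [← Real.rpow_add ht1]; congr 1; ring
      rw [e3]
      calc C * (1 + t) ^ (σ - 1 / 2) * N ^ (-σ) * Real.exp (θ * t - Real.pi * t / 2)
          ≤ C * (1 + t) ^ (σ - 1 / 2) * (N ^ (-(5 / 4) : ℝ) * (1 + t) ^ (5 / 4 - σ)) * 1 := by
            gcongr
        _ = _ := by ring)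
  simpa [gammaExpEdge] using this

theorem one_add_rpow_three_quarters_le {T : ℝ} (hT : 1 ≤ T) :
    (1 + T) ^ ((3 : ℝ) / 4) ≤ 2 * T ^ ((3 : ℝ) / 4) := by
  calc (1 + T) ^ ((3 : ℝ) / 4) ≤ (2 * T) ^ ((3 : ℝ) / 4) := by gcongr; linarith
    _ = 2 ^ ((3 : ℝ) / 4) * T ^ ((3 : ℝ) / 4) := Real.mul_rpow (by norm_num) (by linarith)
    _ ≤ _ := by
      gcongr
      exact Real.rpow_le_self_of_one_le (by norm_num) (by norm_num)

theorem exists_norm_gammaExpEdge_five_quarters_le :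
    ∃ C : ℝ, 0 < C ∧ ∀ N T t : ℝ, 1 ≤ T → T ≤ N → t ≤ T →
      ‖gammaExpEdge ((Real.log N : ℝ) + (Real.pi / 2 : ℝ) * I) (5 / 4) t‖ ≤
        C * (T ^ ((3 : ℝ) / 4) * N ^ (-(5 / 4) : ℝ)) := by
  obtain ⟨C, hC, h⟩ := exists_norm_gammaExp_le
  refine ⟨C * 4, by positivity, fun N T t hT hTN ht => ?_⟩
  have hN : 0 < N := by linarith
  have := intervalIntegral.norm_integral_le_of_norm_le_const (a := 5 / 4) (b := 5 / 4 + 1)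
    (C := C * 4 * (T ^ ((3 : ℝ) / 4) * N ^ (-(5 / 4) : ℝ)))
    (f := fun σ : ℝ => gammaExp ((Real.log N : ℝ) + (Real.pi / 2 : ℝ) * I) (σ + t * I)) (by
      intro σ hσ
      rw [Set.uIoc_of_le (by norm_num)] at hσ
      have hσ1 := hσ.1
      have hσ2 := hσ.2
      refine (h σ (by linarith) (by linarith) (Real.log N) (Real.pi / 2) t).trans ?_
      rw [exp_neg_mul_log hN]
      rcases le_total 0 t with h0 | h0
      · have e1 := exp_mul_sub_le_one (θ := Real.pi / 2)
          (by rw [abs_of_pos (by positivity)]) t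
        rw [abs_of_nonneg h0] at e1 ⊢
        have ht1 : 0 < 1 + t := by linarith
        have e2 : (1 + t) ^ (σ - 5 / 4) ≤ 2 * N ^ (σ - 5 / 4) := by
          calc (1 + t) ^ (σ - 5 / 4) ≤ (2 * N) ^ (σ - 5 / 4) := by
                apply Real.rpow_le_rpow <;> linarith
            _ = 2 ^ (σ - 5 / 4) * N ^ (σ - 5 / 4) := Real.mul_rpow (by norm_num) hN.le
            _ ≤ _ := by
                gcongr
                exact Real.rpow_le_self_of_one_le (by norm_num) (by linarith)
        have e3 : (1 + t) ^ (σ - 1 / 2) = (1 + t) ^ ((3 : ℝ) / 4) * (1 + t) ^ (σ - 5 / 4) := by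
          rw [← Real.rpow_add ht1]; congr 1; ring
        have e4 : (1 + t) ^ ((3 : ℝ) / 4) ≤ 2 * T ^ ((3 : ℝ) / 4) :=
          le_trans (by gcongr) (one_add_rpow_three_quarters_le hT)
        have e5 : N ^ (-(5 / 4) : ℝ) = N ^ (σ - 5 / 4) * N ^ (-σ) := by
          rw [← Real.rpow_add hN]; congr 1; ring
        rw [e3, e5]
        calc C * ((1 + t) ^ ((3 : ℝ) / 4) * (1 + t) ^ (σ - 5 / 4)) * N ^ (-σ) *
              Real.exp (Real.pi / 2 * t - Real.pi * t / 2)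
            ≤ C * ((2 * T ^ ((3 : ℝ) / 4)) * (2 * N ^ (σ - 5 / 4))) * N ^ (-σ) * 1 := by
              gcongr
          _ = _ := by ring
      · have e1 : (1 + |t|) ^ (σ - 1 / 2) ≤ Real.exp (-2 * t) := by
          calc (1 + |t|) ^ (σ - 1 / 2) ≤ (1 + |t|) ^ 2 := by
                rw [← Real.rpow_two]
                exact Real.rpow_le_rpow_of_exponent_le (by linarith [abs_nonneg t]) (by linarith)
            _ ≤ (Real.exp |t|) ^ 2 := by
                gcongr; linarith [Real.add_one_le_exp |t|]
            _ = Real.exp (-2 * t) := by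
                rw [sq, ← Real.exp_add, abs_of_nonpos h0]; congr 1; ring
        have e2 : Real.exp (-2 * t) * Real.exp (Real.pi / 2 * t - Real.pi * |t| / 2) ≤ 1 := by
          rw [← Real.exp_add, Real.exp_le_one_iff, abs_of_nonpos h0]
          nlinarith [Real.pi_gt_three]
        have e3 : N ^ (-σ) ≤ N ^ (-(5 / 4) : ℝ) :=
          Real.rpow_le_rpow_of_exponent_le (by linarith) (by linarith)
        have e4 : 1 ≤ 4 * T ^ ((3 : ℝ) / 4) := by
          have : 1 ≤ T ^ ((3 : ℝ) / 4) := Real.one_le_rpow hT (by norm_num)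
          linarith
        calc C * (1 + |t|) ^ (σ - 1 / 2) * N ^ (-σ) *
              Real.exp (Real.pi / 2 * t - Real.pi * |t| / 2)
            ≤ C * Real.exp (-2 * t) * N ^ (-(5 / 4) : ℝ) *
              Real.exp (Real.pi / 2 * t - Real.pi * |t| / 2) := by gcongr
          _ = C * N ^ (-(5 / 4) : ℝ) * (Real.exp (-2 * t) *
              Real.exp (Real.pi / 2 * t - Real.pi * |t| / 2)) := by ring
          _ ≤ C * N ^ (-(5 / 4) : ℝ) * (4 * T ^ ((3 : ℝ) / 4)) := by
              exact mul_le_mul_of_nonneg_left (e2.trans e4) (by positivity)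
          _ = _ := by ring)
  have e : ((5 / 4 + 1 : ℝ) - 5 / 4) = 1 := by norm_num
  rw [e, abs_one, mul_one] at this
  exact this

theorem exists_norm_integral_Iic_gammaExp_le :
    ∃ C : ℝ, 0 < C ∧ ∀ N T : ℝ, 1 ≤ T → T < N →
      ‖∫ t in Set.Iic T, gammaExp ((Real.log N : ℝ) + (Real.pi / 2 : ℝ) * I)
        ((5 / 4 : ℝ) + t * I)‖ ≤ C * (T ^ ((3 : ℝ) / 4) * N ^ (-(5 / 4) : ℝ) * (N / (N - T))) := by
  obtain ⟨C, hC, h⟩ := exists_norm_gammaExpEdge_five_quarters_le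
  refine ⟨2 * C, by positivity, fun N T hT hTN => ?_⟩
  have hN : 0 < N := by linarith
  set w : ℂ := (Real.log N : ℝ) + (Real.pi / 2 : ℝ) * I with hw
  set M : ℝ := C * (T ^ ((3 : ℝ) / 4) * N ^ (-(5 / 4) : ℝ)) with hM
  have hM0 : 0 ≤ M := by positivity
  have hwre : w.re = Real.log N := by simp [hw]
  have hexp : Complex.exp (-w) = -I / N := by
    rw [hw, neg_add, Complex.exp_add, ← Complex.ofReal_neg, ← Complex.ofReal_exp,
      Real.exp_neg, Real.exp_log hN]
    have : Complex.exp (-((Real.pi / 2 : ℝ) * I)) = -I := by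
      rw [Complex.exp_neg]
      push_cast
      rw [Complex.exp_pi_div_two_mul_I, Complex.inv_I]
    rw [this]
    push_cast
    ring
  have hfin : ∀ R : ℝ, R ≤ T → ‖∫ t in R..T, gammaExp w ((5 / 4 : ℝ) + t * I)‖ ≤
      2 * M * (N / (N - T)) := by
    intro R hR
    have hpos : ∀ t ∈ Set.Icc R T, 0 < N - t := fun t ht => by linarith [ht.2]
    have := norm_integral_gammaExp_le w (a := 5 / 4) (A := R) (B := T) (by norm_num) hR
      (D := fun t => (N - t) / N) (Φ := fun t => M * N / (N - t))
      (φ := fun t => M * N / (N - t) ^ 2) (h := fun _ => M)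
      (fun t ht => div_pos (hpos t ht) hN)
      (fun t ht => by
        refine le_trans (le_of_eq ?_) (Complex.re_le_norm _)
        rw [hexp]
        have : (1 : ℂ) - (((5 / 4 : ℝ) : ℂ) + t * I) * (-I / N) =
            ((1 - t / N : ℝ) : ℂ) + ((5 / 4 / N : ℝ) : ℂ) * I := by
          push_cast
          linear_combination (t / N : ℂ) * Complex.I_sq
        rw [this]
        simp
        field_simp)
      (fun t ht => h N T t hT hTN.le ht.2)
      (fun t ht => by
        have h1 : HasDerivAt (fun t : ℝ => N - t) (-1) t := by
          simpa using (hasDerivAt_id t).const_sub N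
        have h2 := (h1.fun_inv (hpos t ht).ne').const_mul (M * N)
        refine (h2.congr_deriv ?_)
        have := (hpos t ht).ne'
        field_simp)
      (by
        refine ContinuousOn.div (by fun_prop) (by fun_prop) fun t ht => ?_
        exact pow_ne_zero 2 (hpos t ht).ne')
      (fun t ht => by
        rw [hwre, Real.exp_neg, Real.exp_log hN]
        have := (hpos t ht).ne'
        apply le_of_eq
        field_simp)
    refine this.trans (le_of_eq ?_)
    have h1 := (hpos T (Set.right_mem_Icc.2 hR)).ne'
    have h2 := (hpos R (Set.left_mem_Icc.2 hR)).ne'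
    field_simp
    ring
  have hlim := intervalIntegral_tendsto_integral_Iic T
    (integrableOn_gammaExp_Iic (σ := 5 / 4) (by norm_num) (by norm_num) (Real.log N)
      (θ := Real.pi / 2) (by positivity) le_rfl T) tendsto_id
  refine le_of_tendsto hlim.norm ?_
  filter_upwards [eventually_le_atBot T] with R hR
  refine (hfin R hR).trans (le_of_eq ?_)
  rw [hM]
  ring

theorem exists_norm_integral_gammaExp_quarter_le :
    ∃ C : ℝ, 0 < C ∧ ∀ N T X θ : ℝ, 1 ≤ T → 0 < N → N < T → T ≤ X → |θ| ≤ Real.pi / 2 →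
      ‖∫ t in T..X, gammaExp ((Real.log N : ℝ) + θ * I) ((1 / 4 : ℝ) + t * I)‖ ≤
        C * (T ^ ((3 : ℝ) / 4) * N ^ (-(5 / 4) : ℝ) * (N / (T - N))) := by
  obtain ⟨C, hC, h⟩ := exists_norm_gammaExpEdge_quarter_le
  refine ⟨10 * C, by positivity, fun N T X θ hT hN hNT hTX hθ => ?_⟩
  set w : ℂ := (Real.log N : ℝ) + θ * I with hw
  have hwre : w.re = Real.log N := by simp [hw]
  have hTN : 0 < T - N := by linarith
  set P : ℝ := 2 * C * N ^ (-(5 / 4) : ℝ) * (T / (T - N)) ^ ((3 : ℝ) / 4) with hP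
  have hP0 : 0 ≤ P := by positivity
  have hpos : ∀ t ∈ Set.Icc T X, 0 < t - N := fun t ht => by linarith [ht.1]
  have key := norm_integral_gammaExp_le w (a := 1 / 4) (A := T) (B := X) (by norm_num) hTX
      (D := fun t => (t - N) / N) (Φ := fun t => -4 * (P * N) * (t - N) ^ (-(1 / 4) : ℝ))
      (φ := fun t => P * N * (t - N) ^ (-(5 / 4) : ℝ)) (h := fun t => P * (t - N) ^ ((3 : ℝ) / 4))
      (fun t ht => div_pos (hpos t ht) hN)
      (fun t ht => by
        have h1 : t / N ≤ ‖(((1 / 4 : ℝ) : ℂ) + t * I) * Complex.exp (-w)‖ := by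
          rw [norm_mul, Complex.norm_exp, Complex.neg_re, hwre, Real.exp_neg, Real.exp_log hN,
            div_eq_mul_inv]
          gcongr
          refine le_trans ?_ (Complex.abs_im_le_norm _)
          simp [le_abs_self]
        have h2 := norm_sub_norm_le ((((1 / 4 : ℝ) : ℂ) + t * I) * Complex.exp (-w)) 1
        rw [norm_one, norm_sub_rev] at h2
        have : (t - N) / N = t / N - 1 := by field_simp
        linarith)
      (fun t ht => by
        have ht1 : 1 ≤ t := hT.trans ht.1
        refine (h N θ t hN hθ (by linarith) (by linarith [ht.1])).trans ?_
        have e1 := one_add_rpow_three_quarters_le ht1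
        have e2 : t ^ ((3 : ℝ) / 4) ≤
            (T / (T - N)) ^ ((3 : ℝ) / 4) * (t - N) ^ ((3 : ℝ) / 4) := by
          rw [← Real.mul_rpow (by positivity) (hpos t ht).le]
          gcongr
          rw [div_mul_eq_mul_div, le_div_iff₀ hTN]
          nlinarith [ht.1]
        calc C * ((1 + t) ^ ((3 : ℝ) / 4) * N ^ (-(5 / 4) : ℝ))
            ≤ C * ((2 * ((T / (T - N)) ^ ((3 : ℝ) / 4) * (t - N) ^ ((3 : ℝ) / 4))) *
              N ^ (-(5 / 4) : ℝ)) := by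
              gcongr; exact e1.trans (by gcongr)
          _ = _ := by rw [hP]; ring)
      (fun t ht => by
        have h1 : HasDerivAt (fun t : ℝ => t - N) 1 t := (hasDerivAt_id t).sub_const N
        have h2 := (h1.rpow_const (p := (-(1 / 4) : ℝ)) (Or.inl (hpos t ht).ne')).const_mul
          (-4 * (P * N))
        refine h2.congr_deriv ?_
        have : (-(1 / 4) - 1 : ℝ) = -(5 / 4) := by norm_num
        rw [this]
        ring)
      (by
        refine ContinuousOn.mul (by fun_prop) (ContinuousOn.rpow_const (by fun_prop) ?_)
        exact fun t ht => Or.inl (hpos t ht).ne')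
      (fun t ht => by
        rw [hwre, Real.exp_neg, Real.exp_log hN]
        have h0 := hpos t ht
        have e : (t - N) ^ ((3 : ℝ) / 4) = (t - N) ^ (-(5 / 4) : ℝ) * (t - N) ^ 2 := by
          rw [← Real.rpow_two, ← Real.rpow_add h0]; norm_num
        rw [e]
        apply le_of_eq
        have := h0.ne'
        field_simp)
  refine key.trans ?_
  have hq : ∀ u : ℝ, 0 < u → P * u ^ ((3 : ℝ) / 4) / (u / N) = P * N * u ^ (-(1 / 4) : ℝ) := by
    intro u hu
    have e : u ^ ((3 : ℝ) / 4) = u ^ (-(1 / 4) : ℝ) * u := by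
      nth_rewrite 3 [← Real.rpow_one u]
      rw [← Real.rpow_add hu]; norm_num
    rw [e]
    field_simp
  rw [hq _ (hpos X (Set.right_mem_Icc.2 hTX)), hq _ hTN]
  have h3 : 0 ≤ P * N * (X - N) ^ (-(1 / 4) : ℝ) := by
    have := hpos X (Set.right_mem_Icc.2 hTX)
    positivity
  have h4 : P * (T - N) ^ (-(1 / 4) : ℝ) =
      2 * C * N ^ (-(5 / 4) : ℝ) * (T ^ ((3 : ℝ) / 4) / (T - N)) := by
    rw [hP, Real.div_rpow (by linarith) hTN.le]
    have e : (T - N) ^ ((3 : ℝ) / 4) = (T - N) ^ (-(1 / 4) : ℝ) * (T - N) := by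
      nth_rewrite 3 [← Real.rpow_one (T - N)]
      rw [← Real.rpow_add hTN]; norm_num
    rw [e]
    have : 0 < (T - N) ^ (-(1 / 4) : ℝ) := by positivity
    field_simp
  have h5 : 5 * N * (P * (T - N) ^ (-(1 / 4) : ℝ)) =
      10 * C * (T ^ ((3 : ℝ) / 4) * N ^ (-(5 / 4) : ℝ) * (N / (T - N))) := by
    rw [h4]; ring
  linarith

theorem exists_norm_integral_Iic_gammaExp_quarter_sub_le :
    ∃ C : ℝ, 0 < C ∧ ∀ N T θ : ℝ, 1 ≤ T → 0 < N → N < T → 0 ≤ θ → θ < Real.pi / 2 →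
      ‖(∫ t in Set.Iic T, gammaExp ((Real.log N : ℝ) + θ * I) ((1 / 4 : ℝ) + t * I)) -
        2 * Real.pi * Complex.exp (-Complex.exp ((Real.log N : ℝ) + θ * I))‖ ≤
        C * (T ^ ((3 : ℝ) / 4) * N ^ (-(5 / 4) : ℝ) * (N / (T - N))) := by
  obtain ⟨C, hC, h⟩ := exists_norm_integral_gammaExp_quarter_le
  refine ⟨C, hC, fun N T θ hT hN hNT hθ hθ' => ?_⟩
  have hw : |(((Real.log N : ℝ) : ℂ) + θ * I).im| < Real.pi / 2 := by
    simpa [abs_of_nonneg hθ] using hθ'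
  have hf_int := integrable_gammaExp_quarter hw
  rw [← integral_gammaExp hw, ← intervalIntegral.integral_Iic_add_Ioi (b := T)
    hf_int.integrableOn hf_int.integrableOn, sub_add_cancel_left, norm_neg]
  have hlim := intervalIntegral_tendsto_integral_Ioi T (hf_int.integrableOn (s := Set.Ioi T))
    tendsto_id
  refine le_of_tendsto hlim.norm ?_
  filter_upwards [eventually_ge_atTop T] with X hX
  exact h N T X θ hT hN hNT hX (by rw [abs_of_nonneg hθ]; exact hθ'.le)

theorem tendsto_integral_Iic_gammaExp_quarter (L T : ℝ) :
    Tendsto (fun θ : ℝ => ∫ t in Set.Iic T, gammaExp (L + θ * I) ((1 / 4 : ℝ) + t * I))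
      (nhdsWithin (Real.pi / 2) (Set.Iio (Real.pi / 2)))
      (nhds (∫ t in Set.Iic T, gammaExp (L + (Real.pi / 2 : ℝ) * I) ((1 / 4 : ℝ) + t * I))) := by
  obtain ⟨C, hC, h⟩ := exists_norm_gammaExp_le_of_le
  refine tendsto_integral_filter_of_dominated_convergence
    (fun t => C * (1 + |T|) ^ 2 * Real.exp (-(1 / 4 * L)) * Real.exp (t / 2)) ?_ ?_
    ((integrableOn_exp_half_Iic T).const_mul _) ?_
  · exact Eventually.of_forall fun θ =>
      (continuous_gammaExp_vertical _ (by norm_num)).aestronglyMeasurable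
  · have h0 : ∀ᶠ θ in nhdsWithin (Real.pi / 2) (Set.Iio (Real.pi / 2)), 0 ≤ θ :=
      nhdsWithin_le_nhds (eventually_ge_nhds (by positivity))
    filter_upwards [h0, self_mem_nhdsWithin] with θ hθ hθ'
    refine (ae_restrict_iff' measurableSet_Iic).2 (Eventually.of_forall fun t ht => ?_)
    exact h (1 / 4) le_rfl (by norm_num) L θ t |T| hθ (le_of_lt hθ') (abs_nonneg _)
      (le_trans ht (le_abs_self _))
  · refine Eventually.of_forall fun t => ?_
    have : Continuous fun θ : ℝ => gammaExp (L + θ * I) ((1 / 4 : ℝ) + t * I) := by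
      unfold gammaExp
      fun_prop
    exact (this.tendsto _).mono_left nhdsWithin_le_nhds

theorem exists_norm_integral_Iic_gammaExp_quarter_sub_two_pi_le :
    ∃ C : ℝ, 0 < C ∧ ∀ (n : ℕ) (T : ℝ), 1 ≤ n → 1 ≤ T → 2 * Real.pi * n < T →
      ‖(∫ t in Set.Iic T, gammaExp ((Real.log (2 * Real.pi * n) : ℝ) + (Real.pi / 2 : ℝ) * I)
        ((1 / 4 : ℝ) + t * I)) - 2 * Real.pi‖ ≤
        C * (T ^ ((3 : ℝ) / 4) * (2 * Real.pi * n) ^ (-(5 / 4) : ℝ) *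
          (2 * Real.pi * n / (T - 2 * Real.pi * n))) := by
  obtain ⟨C, hC, h⟩ := exists_norm_integral_Iic_gammaExp_quarter_sub_le
  refine ⟨C, hC, fun n T hn hT hNT => ?_⟩
  have hn0 : (0 : ℝ) < n := by exact_mod_cast hn
  have hN : 0 < 2 * Real.pi * n := by positivity
  have h1 := tendsto_integral_Iic_gammaExp_quarter (Real.log (2 * Real.pi * n)) T
  have h2 : Tendsto (fun θ : ℝ => 2 * (Real.pi : ℂ) *
      Complex.exp (-Complex.exp ((Real.log (2 * Real.pi * n) : ℝ) + θ * I)))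
      (nhdsWithin (Real.pi / 2) (Set.Iio (Real.pi / 2))) (nhds (2 * Real.pi)) := by
    have hc : Continuous (fun θ : ℝ => 2 * (Real.pi : ℂ) *
      Complex.exp (-Complex.exp ((Real.log (2 * Real.pi * n) : ℝ) + θ * I))) := by fun_prop
    have := (hc.tendsto (Real.pi / 2)).mono_left
      (nhdsWithin_le_nhds (s := Set.Iio (Real.pi / 2)))
    convert this using 2
    have e : Complex.exp (-Complex.exp ((Real.log (2 * Real.pi * n) : ℝ) +
        (Real.pi / 2 : ℝ) * I)) = 1 := by
      rw [Complex.exp_add, ← Complex.ofReal_exp, Real.exp_log hN, Complex.exp_eq_one_iff]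
      refine ⟨-n, ?_⟩
      push_cast
      rw [Complex.exp_pi_div_two_mul_I]
      ring
    rw [e, mul_one]
  refine le_of_tendsto (h1.sub h2).norm ?_
  have h0 : ∀ᶠ θ in nhdsWithin (Real.pi / 2) (Set.Iio (Real.pi / 2)), 0 ≤ θ :=
    nhdsWithin_le_nhds (eventually_ge_nhds (by positivity))
  filter_upwards [h0, self_mem_nhdsWithin] with θ hθ hθ'
  exact h _ T θ hT hN hNT hθ hθ'

theorem integral_Iic_gammaExp_five_quarters {L : ℝ} (hL : 0 ≤ L) (T : ℝ) :
    ∫ t in Set.Iic T, gammaExp (L + (Real.pi / 2 : ℝ) * I) ((5 / 4 : ℝ) + t * I) =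
      (∫ t in Set.Iic T, gammaExp (L + (Real.pi / 2 : ℝ) * I) ((1 / 4 : ℝ) + t * I)) -
        I * gammaExpEdge (L + (Real.pi / 2 : ℝ) * I) (1 / 4) T := by
  obtain ⟨C, hC, h⟩ := exists_norm_gammaExpEdge_quarter_le_exp
  set w : ℂ := L + (Real.pi / 2 : ℝ) * I with hw
  have h5 := intervalIntegral_tendsto_integral_Iic T
    (integrableOn_gammaExp_Iic (σ := 5 / 4) (by norm_num) (by norm_num) L
      (θ := Real.pi / 2) (by positivity) le_rfl T) tendsto_id
  have h1 := intervalIntegral_tendsto_integral_Iic T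
    (integrableOn_gammaExp_Iic (σ := 1 / 4) (by norm_num) (by norm_num) L
      (θ := Real.pi / 2) (by positivity) le_rfl T) tendsto_id
  have h0 : Tendsto (fun R : ℝ => gammaExpEdge w (1 / 4) R) atBot (nhds 0) := by
    have e : Tendsto (fun R : ℝ => C * Real.exp (R / 2)) atBot (nhds 0) := by
      have := (Real.tendsto_exp_atBot.comp
        (tendsto_id.atBot_div_const (show (0 : ℝ) < 2 by norm_num))).const_mul C
      simpa using this
    refine squeeze_zero_norm' ?_ e
    filter_upwards [eventually_le_atBot 0] with R hR
    exact h L R hL hR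
  have h6 := h1.add ((h0.sub_const (gammaExpEdge w (1 / 4) T)).const_mul I)
  refine (tendsto_nhds_unique h5 (h6.congr fun R => ?_)).trans (by ring)
  have := gammaExpEdge_eq w (a := 1 / 4) (by norm_num) R T
  have e : (1 / 4 + 1 : ℝ) = 5 / 4 := by norm_num
  rw [e] at this
  rw [this]
  simp only [id]
  linear_combination (-((∫ t in R..T, gammaExp w ((5 / 4 : ℝ) + t * I)) -
    ∫ t in R..T, gammaExp w ((1 / 4 : ℝ) + t * I))) * Complex.I_sq

/-- The `n`-th term of the expansion on the line `Re s = 5 / 4`. -/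
noncomputable def gammaExpTerm (n : ℕ) (T : ℝ) : ℂ :=
  ∫ t in Set.Iic T, gammaExp ((Real.log (2 * Real.pi * n) : ℝ) + (Real.pi / 2 : ℝ) * I)
    ((5 / 4 : ℝ) + t * I)

theorem exists_norm_gammaExpTerm_sub_le :
    ∃ C : ℝ, 0 < C ∧ ∀ (n : ℕ) (T : ℝ), 1 ≤ n → 1 ≤ T → 2 * Real.pi * n ≠ T →
      ‖gammaExpTerm n T - (if 2 * Real.pi * n < T then 2 * Real.pi else 0 : ℝ)‖ ≤
        C * (T ^ ((3 : ℝ) / 4) * (2 * Real.pi * n) ^ (-(5 / 4) : ℝ) *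
          (1 + 2 * Real.pi * n / |T - 2 * Real.pi * n|)) := by
  obtain ⟨C₁, hC₁, h₁⟩ := exists_norm_integral_Iic_gammaExp_le
  obtain ⟨C₂, hC₂, h₂⟩ := exists_norm_integral_Iic_gammaExp_quarter_sub_two_pi_le
  obtain ⟨C₃, hC₃, h₃⟩ := exists_norm_gammaExpEdge_quarter_le
  refine ⟨C₁ + C₂ + 2 * C₃, by positivity, fun n T hn hT hne => ?_⟩
  have hn1 : (1 : ℝ) ≤ n := by exact_mod_cast hn
  have hN1 : 1 ≤ 2 * Real.pi * n := by nlinarith [Real.pi_gt_three]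
  set N : ℝ := 2 * Real.pi * n with hN
  have hN0 : 0 < N := by linarith
  set B : ℝ := T ^ ((3 : ℝ) / 4) * N ^ (-(5 / 4) : ℝ) with hB
  have hB0 : 0 ≤ B := by positivity
  rcases lt_or_gt_of_ne hne with hlt | hgt
  · rw [if_pos hlt, gammaExpTerm, integral_Iic_gammaExp_five_quarters (Real.log_nonneg hN1)]
    have e1 := h₂ n T hn hT hlt
    have e2 : ‖gammaExpEdge ((Real.log N : ℝ) + (Real.pi / 2 : ℝ) * I) (1 / 4) T‖ ≤
        2 * C₃ * B := by
      refine (h₃ N (Real.pi / 2) T hN0 (by rw [abs_of_pos (by positivity)]) (by linarith)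
        (by linarith)).trans ?_
      calc _ ≤ C₃ * ((2 * T ^ ((3 : ℝ) / 4)) * N ^ (-(5 / 4) : ℝ)) := by
            gcongr; exact one_add_rpow_three_quarters_le hT
        _ = _ := by rw [hB]; ring
    rw [abs_of_pos (by linarith)]
    have h0 : 0 < N / (T - N) := div_pos hN0 (by linarith)
    set A := ∫ t in Set.Iic T, gammaExp ((Real.log N : ℝ) + (Real.pi / 2 : ℝ) * I)
      ((1 / 4 : ℝ) + t * I)
    set E := gammaExpEdge ((Real.log N : ℝ) + (Real.pi / 2 : ℝ) * I) (1 / 4) T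
    have e3 : A - I * E - ((2 * Real.pi : ℝ) : ℂ) = (A - 2 * Real.pi) - I * E := by
      push_cast; ring
    rw [e3]
    refine (norm_sub_le _ _).trans ?_
    rw [norm_mul, Complex.norm_I, one_mul]
    have : 0 ≤ B * (N / (T - N)) := by positivity
    nlinarith [mul_nonneg hC₁.le hB0, mul_nonneg hC₂.le hB0, mul_nonneg hC₁.le this,
      mul_nonneg hC₃.le this]
  · rw [if_neg (by linarith), Complex.ofReal_zero, sub_zero]
    have e1 := h₁ N T hT hgt
    rw [abs_of_neg (by linarith), neg_sub]
    have h0 : 0 < N / (N - T) := div_pos hN0 (by linarith)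
    refine e1.trans ?_
    have : 0 ≤ B * (N / (N - T)) := by positivity
    nlinarith [mul_nonneg hC₁.le hB0, mul_nonneg hC₂.le hB0, mul_nonneg hC₃.le hB0,
      mul_nonneg hC₂.le this, mul_nonneg hC₃.le this]

theorem rpow_mul_inv_le_add {a b : ℝ} (ha : 0 < a) (hb : 0 < b) :
    a ^ (-(1 / 8) : ℝ) * b⁻¹ ≤ a ^ (-(9 / 8) : ℝ) + b ^ (-(9 / 8) : ℝ) := by
  have key : ∀ v : ℝ, 0 < v → v ≤ a → v ≤ b → a ^ (-(1 / 8) : ℝ) * b⁻¹ ≤ v ^ (-(9 / 8) : ℝ) := by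
    intro v hv hva hvb
    have e : v ^ (-(9 / 8) : ℝ) = v ^ (-(1 / 8) : ℝ) * v⁻¹ := by
      rw [← Real.rpow_neg_one v, ← Real.rpow_add hv]; norm_num
    rw [e]
    have h1 : a ^ (-(1 / 8) : ℝ) ≤ v ^ (-(1 / 8) : ℝ) :=
      Real.rpow_le_rpow_of_nonpos hv hva (by norm_num)
    gcongr
  have h1 : 0 ≤ a ^ (-(9 / 8) : ℝ) := by positivity
  have h2 : 0 ≤ b ^ (-(9 / 8) : ℝ) := by positivity
  rcases le_total a b with h | h
  · linarith [key a ha le_rfl h]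
  · linarith [key b hb h le_rfl]

theorem exists_d3_mul_rpow_le :
    ∃ C : ℝ, 0 < C ∧ ∀ n : ℕ, 1 ≤ n →
      (d3 n : ℝ) * (2 * Real.pi * n) ^ (-(5 / 4) : ℝ) ≤ C * (n : ℝ) ^ (-(9 / 8) : ℝ) := by
  obtain ⟨C, hC, h⟩ := exists_d3_le
  refine ⟨C, hC, fun n hn => ?_⟩
  have hn0 : (0 : ℝ) < n := by exact_mod_cast hn
  have h1 : (2 * Real.pi * n) ^ (-(5 / 4) : ℝ) ≤ (n : ℝ) ^ (-(5 / 4) : ℝ) := by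
    apply Real.rpow_le_rpow_of_nonpos hn0 _ (by norm_num)
    nlinarith [Real.pi_gt_three]
  calc (d3 n : ℝ) * (2 * Real.pi * n) ^ (-(5 / 4) : ℝ)
      ≤ (C * (n : ℝ) ^ ((1 : ℝ) / 8)) * (n : ℝ) ^ (-(5 / 4) : ℝ) := by
        gcongr; exact h n
    _ = _ := by
      rw [mul_assoc, ← Real.rpow_add hn0]; norm_num

theorem exists_norm_sub_le_of_hasSum_gammaExpTerm :
    ∃ C : ℝ, 0 < C ∧ ∀ (m : ℕ) (S : ℂ),
      HasSum (fun n : ℕ => (d3 n : ℂ) * gammaExpTerm n (2 * Real.pi * (m + 1 / 2))) S →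
      ‖S - 2 * Real.pi * ∑ k ∈ Finset.Icc 1 m, (d3 k : ℂ)‖ ≤
        C * (2 * Real.pi * (m + 1 / 2)) ^ ((3 : ℝ) / 4) := by
  obtain ⟨C₁, hC₁, h₁⟩ := exists_norm_gammaExpTerm_sub_le
  obtain ⟨C₂, hC₂, h₂⟩ := exists_d3_mul_rpow_le
  have s1 : Summable fun n : ℕ => (n : ℝ) ^ (-(9 / 8) : ℝ) :=
    Real.summable_nat_rpow.2 (by norm_num)
  have s2 : Summable fun k : ℤ => |(k : ℝ) - 1 / 2| ^ (-(9 / 8) : ℝ) := by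
    have := (Real.summable_one_div_int_add_rpow (-(1 / 2)) (9 / 8)).2 (by norm_num)
    refine this.congr fun k => ?_
    rw [Real.rpow_neg (abs_nonneg _), one_div, sub_eq_add_neg]
  set K : ℝ := 2 * (∑' n : ℕ, (n : ℝ) ^ (-(9 / 8) : ℝ)) +
    ∑' k : ℤ, |(k : ℝ) - 1 / 2| ^ (-(9 / 8) : ℝ) with hK
  have hK0 : 0 ≤ K := add_nonneg
    (mul_nonneg (by norm_num) (tsum_nonneg fun n => by positivity))
    (tsum_nonneg fun n => by positivity)
  refine ⟨C₁ * C₂ * K + 1, by positivity, fun m S hS => ?_⟩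
  set T : ℝ := 2 * Real.pi * (m + 1 / 2) with hT
  have hm0 : (0 : ℝ) ≤ m := m.cast_nonneg
  have hT1 : 1 ≤ T := by
    have : Real.pi ≤ T := by rw [hT]; nlinarith [Real.pi_pos]
    linarith [Real.pi_gt_three]
  have hlt : ∀ n : ℕ, 2 * Real.pi * n < T ↔ n ≤ m := by
    intro n
    rw [hT, mul_lt_mul_iff_right₀ (by positivity)]
    constructor
    · intro h
      by_contra hcon
      have : m + 1 ≤ n := by omega
      have : (m + 1 : ℝ) ≤ n := by exact_mod_cast this
      linarith
    · intro h
      have : (n : ℝ) ≤ m := by exact_mod_cast h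
      linarith
  have hfin : HasSum (fun n : ℕ => (d3 n : ℂ) *
      ((if 2 * Real.pi * n < T then 2 * Real.pi else 0 : ℝ) : ℂ))
      (2 * Real.pi * ∑ k ∈ Finset.Icc 1 m, (d3 k : ℂ)) := by
    have : 2 * (Real.pi : ℂ) * ∑ k ∈ Finset.Icc 1 m, (d3 k : ℂ) = ∑ n ∈ Finset.Icc 1 m,
        (d3 n : ℂ) * ((if 2 * Real.pi * n < T then 2 * Real.pi else 0 : ℝ) : ℂ) := by
      rw [Finset.mul_sum]
      refine Finset.sum_congr rfl fun n hn => ?_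
      rw [if_pos ((hlt n).2 (Finset.mem_Icc.1 hn).2)]
      push_cast
      ring
    rw [this]
    refine hasSum_sum_of_ne_finset_zero fun n hn => ?_
    rcases Nat.eq_zero_or_pos n with h0 | h0
    · rw [h0, d3_zero]; simp
    · have : ¬ n ≤ m := fun h => hn (Finset.mem_Icc.2 ⟨h0, h⟩)
      rw [if_neg (fun h => this ((hlt n).1 h))]
      simp
  have hinj : Function.Injective fun n : ℕ => (n : ℤ) - m := by
    intro a b hab
    simpa using hab
  have s3 := s2.comp_injective hinj
  have s3le := _root_.tsum_comp_le_tsum_of_inj s2 (fun k => by positivity) hinj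
  have hg : HasSum (fun n : ℕ => C₁ * C₂ * T ^ ((3 : ℝ) / 4) * (2 * (n : ℝ) ^ (-(9 / 8) : ℝ) +
      |(((n : ℤ) - m : ℤ) : ℝ) - 1 / 2| ^ (-(9 / 8) : ℝ))) _ :=
    ((s1.hasSum.mul_left 2).add s3.hasSum).mul_left (C₁ * C₂ * T ^ ((3 : ℝ) / 4))
  have hbound := (hS.sub hfin).norm_le_of_bounded hg (fun n => by
    rcases Nat.eq_zero_or_pos n with h0 | h0
    · rw [h0, d3_zero]
      simp only [Nat.cast_zero, zero_mul, sub_zero, norm_zero]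
      positivity
    · have hn0 : (0 : ℝ) < n := by exact_mod_cast h0
      rw [← mul_sub, norm_mul, Complex.norm_natCast]
      have hne : 2 * Real.pi * n ≠ T := by
        rw [hT]
        intro h
        have h := mul_left_cancel₀ (by positivity) h
        have h' : ((2 * n : ℕ) : ℝ) = ((2 * m + 1 : ℕ) : ℝ) := by push_cast; linarith
        have := Nat.cast_injective h'
        omega
      set u : ℝ := |(((n : ℤ) - m : ℤ) : ℝ) - 1 / 2| with hu
      have hTu : |T - 2 * Real.pi * n| = 2 * Real.pi * u := by
        have : T - 2 * Real.pi * n = -(2 * Real.pi * ((((n : ℤ) - m : ℤ) : ℝ) - 1 / 2)) := by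
          rw [hT]; push_cast; ring
        rw [this, abs_neg, abs_mul, abs_of_pos (by positivity)]
      have hu0 : 0 < u := by
        have : 0 < 2 * Real.pi * u := by
          rw [← hTu]; exact abs_pos.2 (sub_ne_zero.2 hne.symm)
        exact pos_of_mul_pos_right this (by positivity)
      have hA := h₁ n T h0 hT1 hne
      have hB := h₂ n h0
      have hq : 2 * Real.pi * n / |T - 2 * Real.pi * n| = n * u⁻¹ := by
        rw [hTu]; field_simp
      rw [hq] at hA
      have e : (n : ℝ) ^ (-(1 / 8) : ℝ) = (n : ℝ) ^ (-(9 / 8) : ℝ) * n := by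
        nth_rewrite 3 [← Real.rpow_one (n : ℝ)]
        rw [← Real.rpow_add hn0]; norm_num
      have hY := rpow_mul_inv_le_add hn0 hu0
      rw [e] at hY
      calc _ ≤ (d3 n : ℝ) * (C₁ * (T ^ ((3 : ℝ) / 4) * (2 * Real.pi * n) ^ (-(5 / 4) : ℝ) *
              (1 + n * u⁻¹))) := by gcongr
        _ = C₁ * T ^ ((3 : ℝ) / 4) * ((d3 n : ℝ) * (2 * Real.pi * n) ^ (-(5 / 4) : ℝ)) *
              (1 + n * u⁻¹) := by ring
        _ ≤ C₁ * T ^ ((3 : ℝ) / 4) * (C₂ * (n : ℝ) ^ (-(9 / 8) : ℝ)) * (1 + n * u⁻¹) := by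
              gcongr
        _ = C₁ * C₂ * T ^ ((3 : ℝ) / 4) * ((n : ℝ) ^ (-(9 / 8) : ℝ) +
              (n : ℝ) ^ (-(9 / 8) : ℝ) * n * u⁻¹) := by ring
        _ ≤ _ := by
              refine mul_le_mul_of_nonneg_left ?_ (by positivity)
              linarith)
  refine hbound.trans ?_
  have hT0 : 0 ≤ T ^ ((3 : ℝ) / 4) := by positivity
  have : C₁ * C₂ * T ^ ((3 : ℝ) / 4) * (2 * (∑' n : ℕ, (n : ℝ) ^ (-(9 / 8) : ℝ)) +
      ∑' n : ℕ, ((fun k : ℤ => |(k : ℝ) - 1 / 2| ^ (-(9 / 8) : ℝ)) ∘ fun n : ℕ => (n : ℤ) - m) n) ≤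
      C₁ * C₂ * T ^ ((3 : ℝ) / 4) * K := by
    rw [hK]
    gcongr
  refine this.trans ?_
  nlinarith

theorem gammaExp_mul_exp_log {n : ℕ} (hn : 1 ≤ n) (s : ℂ) :
    gammaExp ((Real.log (2 * Real.pi) : ℝ) + (Real.pi / 2 : ℝ) * I) s *
      Complex.exp (-(s * (Real.log n : ℝ))) =
      gammaExp ((Real.log (2 * Real.pi * n) : ℝ) + (Real.pi / 2 : ℝ) * I) s := by
  have hn0 : (n : ℝ) ≠ 0 := by
    have : n ≠ 0 := by omega
    exact_mod_cast this
  rw [gammaExp, gammaExp, mul_assoc, ← Complex.exp_add, Real.log_mul (by positivity) hn0]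
  congr 2
  push_cast
  ring

theorem hasSum_d3_mul_gammaExpTerm {T : ℝ} (hT : 0 ≤ T) :
    HasSum (fun n : ℕ => (d3 n : ℂ) * gammaExpTerm n T)
      (∫ t in Set.Iic T, gammaExp ((Real.log (2 * Real.pi) : ℝ) + (Real.pi / 2 : ℝ) * I)
        ((5 / 4 : ℝ) + t * I) * riemannZeta ((5 / 4 : ℝ) + t * I) ^ 3) := by
  obtain ⟨C₁, hC₁, h₁⟩ := exists_norm_gammaExp_le_of_le
  obtain ⟨C₂, hC₂, h₂⟩ := exists_d3_mul_rpow_le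
  set F : ℕ → ℝ → ℂ := fun n t => (d3 n : ℂ) *
    gammaExp ((Real.log (2 * Real.pi * n) : ℝ) + (Real.pi / 2 : ℝ) * I) ((5 / 4 : ℝ) + t * I)
    with hF
  have hFi : ∀ n, Integrable (F n) (volume.restrict (Set.Iic T)) := fun n =>
    (integrableOn_gammaExp_Iic (by norm_num) (by norm_num) _ (by positivity) le_rfl T).const_mul _
  have hFs : Summable fun n => ∫ t in Set.Iic T, ‖F n t‖ := by
    have s1 : Summable fun n : ℕ => (n : ℝ) ^ (-(9 / 8) : ℝ) :=
      Real.summable_nat_rpow.2 (by norm_num)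
    refine Summable.of_nonneg_of_le (fun n => integral_nonneg fun t => norm_nonneg _) (fun n => ?_)
      (s1.mul_left (C₁ * C₂ * (1 + T) ^ 2 * ∫ t in Set.Iic T, Real.exp (t / 2)))
    have hE : 0 ≤ ∫ t in Set.Iic T, Real.exp (t / 2) :=
      integral_nonneg fun t => Real.exp_nonneg _
    rcases Nat.eq_zero_or_pos n with h0 | h0
    · have : ∀ t, ‖F n t‖ = 0 := fun t => by simp [hF, h0, d3_zero]
      simp only [this, integral_zero]
      positivity
    · have hn0 : (0 : ℝ) < n := by exact_mod_cast h0
      have hN : 0 < 2 * Real.pi * n := by positivity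
      calc ∫ t in Set.Iic T, ‖F n t‖
          ≤ ∫ t in Set.Iic T, (C₁ * C₂ * (1 + T) ^ 2 * (n : ℝ) ^ (-(9 / 8) : ℝ)) *
              Real.exp (t / 2) := by
            refine setIntegral_mono_on (hFi n).norm
              ((integrableOn_exp_half_Iic T).const_mul _) measurableSet_Iic fun t ht => ?_
            simp only [hF]
            rw [norm_mul, Complex.norm_natCast]
            have h3 := h₁ (5 / 4) (by norm_num) (by norm_num) (Real.log (2 * Real.pi * n))
              (Real.pi / 2) t T (by positivity) le_rfl hT ht
            rw [exp_neg_mul_log hN] at h3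
            calc _ ≤ (d3 n : ℝ) * (C₁ * (1 + T) ^ 2 * (2 * Real.pi * n) ^ (-(5 / 4) : ℝ) *
                  Real.exp (t / 2)) := by gcongr
              _ = C₁ * (1 + T) ^ 2 * ((d3 n : ℝ) * (2 * Real.pi * n) ^ (-(5 / 4) : ℝ)) *
                  Real.exp (t / 2) := by ring
              _ ≤ C₁ * (1 + T) ^ 2 * (C₂ * (n : ℝ) ^ (-(9 / 8) : ℝ)) * Real.exp (t / 2) := by
                  have := h₂ n h0
                  gcongr
              _ = _ := by ring
        _ = _ := by rw [integral_const_mul]; ring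
  have key := hasSum_integral_of_summable_integral_norm hFi hFs
  have e1 : (fun n : ℕ => (d3 n : ℂ) * gammaExpTerm n T) = fun n => ∫ t in Set.Iic T, F n t := by
    funext n
    rw [gammaExpTerm]
    exact (integral_const_mul _ _).symm
  have e2 : ∫ t in Set.Iic T, gammaExp ((Real.log (2 * Real.pi) : ℝ) + (Real.pi / 2 : ℝ) * I)
        ((5 / 4 : ℝ) + t * I) * riemannZeta ((5 / 4 : ℝ) + t * I) ^ 3 =
      ∫ t in Set.Iic T, ∑' n, F n t := by
    refine integral_congr_ae (Eventually.of_forall fun t => ?_)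
    have hs := (hasSum_d3 (s := ((5 / 4 : ℝ) : ℂ) + t * I) (by simp; norm_num)).mul_left
      (gammaExp ((Real.log (2 * Real.pi) : ℝ) + (Real.pi / 2 : ℝ) * I) ((5 / 4 : ℝ) + t * I))
    simp only
    rw [← hs.tsum_eq]
    refine tsum_congr fun n => ?_
    rcases Nat.eq_zero_or_pos n with h0 | h0
    · simp [hF, h0, d3_zero]
    · rw [mul_left_comm, gammaExp_mul_exp_log h0]
  rw [e1, e2]
  exact key

theorem exists_norm_riemannZeta_five_quarters_le :
    ∃ K : ℝ, 0 < K ∧ ∀ t : ℝ, ‖riemannZeta ((5 / 4 : ℝ) + t * I)‖ ≤ K := by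
  obtain ⟨δ₀, hδ₀, h⟩ := exists_norm_riemannZeta_le_two_div
  refine ⟨2 / min (δ₀ / 2) (1 / 4), by positivity, fun t => ?_⟩
  refine h _ (by positivity) ((min_le_left _ _).trans_lt (by linarith)) _ ?_
  have := min_le_right (δ₀ / 2) (1 / 4)
  simp
  linarith

theorem continuous_riemannZeta_five_quarters :
    Continuous fun t : ℝ => riemannZeta ((5 / 4 : ℝ) + t * I) := by
  rw [continuous_iff_continuousAt]
  intro t
  have h1 : ContinuousAt riemannZeta ((5 / 4 : ℝ) + t * I) :=
    (differentiableAt_riemannZeta (by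
      intro h
      have := congrArg Complex.re h
      simp at this
      norm_num at this)).continuousAt
  exact ContinuousAt.comp (f := fun t : ℝ => (((5 / 4 : ℝ) : ℂ) + t * I)) h1 (by fun_prop)

theorem norm_gammaExp_neg (L θ σ t : ℝ) :
    ‖gammaExp (L + (-θ : ℝ) * I) (σ + t * I)‖ = ‖gammaExp (L + θ * I) (σ + (-t : ℝ) * I)‖ := by
  rw [norm_gammaExp, norm_gammaExp]
  have : (σ + (-t : ℝ) * I : ℂ) = (starRingEnd ℂ) (σ + t * I) := by
    simp
  rw [this, Complex.Gamma_conj, Complex.norm_conj]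
  congr 3
  ring

theorem integral_exp_neg_half_le (T : ℝ) :
    ∫ t in (1 : ℝ)..T, Real.exp (-t / 2) ≤ 2 := by
  have h : ∀ t ∈ Set.uIcc (1 : ℝ) T, HasDerivAt (fun t : ℝ => -2 * Real.exp (-t / 2))
      (Real.exp (-t / 2)) t := by
    intro t _
    have h1 : HasDerivAt (fun t : ℝ => -t / 2) (-1 / 2) t :=
      ((hasDerivAt_id t).neg).div_const 2
    refine (h1.exp.const_mul (-2)).congr_deriv ?_
    ring
  rw [intervalIntegral.integral_eq_sub_of_hasDerivAt h
    (by apply Continuous.intervalIntegrable; fun_prop)]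
  have h1 := Real.exp_pos (-T / 2)
  have h2 : Real.exp (-1 / 2) ≤ 1 := Real.exp_le_one_iff.2 (by norm_num)
  linarith

theorem exists_norm_integral_zetaCube_five_quarters_sub_le :
    ∃ C : ℝ, 0 < C ∧ ∀ m : ℕ,
      ‖(∫ t in (1 : ℝ)..(2 * Real.pi * (m + 1 / 2)), zetaCube ((5 / 4 : ℝ) + t * I)) -
        2 * Real.pi * ∑ k ∈ Finset.Icc 1 m, (d3 k : ℂ)‖ ≤
        C * (2 * Real.pi * (m + 1 / 2)) ^ ((3 : ℝ) / 4) := by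
  obtain ⟨C₁, hC₁, h₁⟩ := exists_norm_sub_le_of_hasSum_gammaExpTerm
  obtain ⟨C₂, hC₂, h₂⟩ := exists_norm_gammaExp_le_of_le
  obtain ⟨K, hK, hζ⟩ := exists_norm_riemannZeta_five_quarters_le
  set L : ℝ := Real.log (2 * Real.pi) with hL
  set G : ℝ → ℂ := fun t => gammaExp (L + (Real.pi / 2 : ℝ) * I) ((5 / 4 : ℝ) + t * I) *
    riemannZeta ((5 / 4 : ℝ) + t * I) ^ 3 with hG
  set H : ℝ → ℂ := fun t => gammaExp (L + (-(Real.pi / 2) : ℝ) * I) ((5 / 4 : ℝ) + t * I) *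
    riemannZeta ((5 / 4 : ℝ) + t * I) ^ 3 with hH
  have hGc : Continuous G := (continuous_gammaExp_vertical _ (by norm_num)).mul
    (continuous_riemannZeta_five_quarters.pow 3)
  have hHc : Continuous H := (continuous_gammaExp_vertical _ (by norm_num)).mul
    (continuous_riemannZeta_five_quarters.pow 3)
  have hζ3 : ∀ t : ℝ, ‖riemannZeta ((5 / 4 : ℝ) + t * I) ^ 3‖ ≤ K ^ 3 := by
    intro t
    rw [norm_pow]
    have := hζ t
    gcongr
  have hGi : ∀ T : ℝ, IntegrableOn G (Set.Iic T) := fun T =>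
    Integrable.mul_bdd (c := K ^ 3) (integrableOn_gammaExp_Iic (by norm_num) (by norm_num) L
      (by positivity) le_rfl T)
      (continuous_riemannZeta_five_quarters.pow 3).aestronglyMeasurable
      (Eventually.of_forall hζ3)
  have hz : ∀ t : ℝ, zetaCube ((5 / 4 : ℝ) + t * I) = G t + H t := by
    intro t
    rw [zetaCube, riemannZeta_one_sub_eq_gammaExp (by simp) (by
      intro h
      have := congrArg Complex.re h
      simp at this
      norm_num at this)]
    simp only [hG, hH, hL]
    ring
  set E : ℝ := Real.exp (-(5 / 4 * L)) with hE
  refine ⟨C₁ + ‖∫ t in Set.Iic 1, G t‖ + C₂ * E * K ^ 3 * 2, by positivity, fun m => ?_⟩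
  set T : ℝ := 2 * Real.pi * (m + 1 / 2) with hT
  have hm0 : (0 : ℝ) ≤ m := m.cast_nonneg
  have hT1 : 1 ≤ T := by
    have : Real.pi ≤ T := by rw [hT]; nlinarith [Real.pi_pos]
    linarith [Real.pi_gt_three]
  have hHint : ‖∫ t in (1 : ℝ)..T, H t‖ ≤ C₂ * E * K ^ 3 * 2 := by
    calc ‖∫ t in (1 : ℝ)..T, H t‖ ≤ ∫ t in (1 : ℝ)..T, C₂ * E * K ^ 3 * Real.exp (-t / 2) := by
          refine intervalIntegral.norm_integral_le_of_norm_le hT1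
            (Eventually.of_forall fun t ht => ?_)
            (by apply Continuous.intervalIntegrable; fun_prop)
          simp only [hH]
          rw [norm_mul, norm_gammaExp_neg]
          have e1 := h₂ (5 / 4) (by norm_num) (by norm_num) L (Real.pi / 2) (-t) 0 (by positivity)
            le_rfl le_rfl (by linarith [ht.1])
          calc _ ≤ (C₂ * (1 + 0) ^ 2 * Real.exp (-(5 / 4 * L)) * Real.exp (-t / 2)) * K ^ 3 :=
                mul_le_mul e1 (hζ3 t) (norm_nonneg _) (by positivity)
            _ = _ := by rw [hE]; ring
      _ = C₂ * E * K ^ 3 * ∫ t in (1 : ℝ)..T, Real.exp (-t / 2) :=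
          intervalIntegral.integral_const_mul _ _
      _ ≤ _ := by
          have := integral_exp_neg_half_le T
          gcongr
  have hsum := h₁ m _ (hasSum_d3_mul_gammaExpTerm (T := T) (by linarith))
  have hsplit : ∫ t in (1 : ℝ)..T, zetaCube ((5 / 4 : ℝ) + t * I) =
      (∫ t in Set.Iic T, G t) - (∫ t in Set.Iic 1, G t) + ∫ t in (1 : ℝ)..T, H t := by
    rw [intervalIntegral.integral_Iic_sub_Iic (hGi 1) (hGi T),
      ← intervalIntegral.integral_add (hGc.intervalIntegrable _ _) (hHc.intervalIntegrable _ _)]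
    exact intervalIntegral.integral_congr fun t _ => hz t
  rw [hsplit]
  have hTp : 1 ≤ T ^ ((3 : ℝ) / 4) := Real.one_le_rpow hT1 (by norm_num)
  have e : (∫ t in Set.Iic T, G t) - (∫ t in Set.Iic 1, G t) + (∫ t in (1 : ℝ)..T, H t) -
      2 * Real.pi * ∑ k ∈ Finset.Icc 1 m, (d3 k : ℂ) =
      ((∫ t in Set.Iic T, G t) - 2 * Real.pi * ∑ k ∈ Finset.Icc 1 m, (d3 k : ℂ)) -
        (∫ t in Set.Iic 1, G t) + (∫ t in (1 : ℝ)..T, H t) := by ring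
  rw [e]
  refine (norm_add_le _ _).trans ((add_le_add ((norm_sub_le _ _).trans
    (add_le_add_left hsum _)) hHint).trans ?_)
  have h3 : 0 ≤ ‖∫ t in Set.Iic 1, G t‖ + C₂ * E * K ^ 3 * 2 := by positivity
  nlinarith

theorem continuous_zetaCube_half : Continuous fun t : ℝ => zetaCube ((1 / 2 : ℝ) + t * I) := by
  rw [continuous_iff_continuousAt]
  intro t
  have h1 : ContinuousAt zetaCube ((1 / 2 : ℝ) + t * I) := (differentiableAt_zetaCube
    (by intro h; have := congrArg Complex.re h; norm_num at this)
    (by intro h; have := congrArg Complex.re h; norm_num at this)).continuousAt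
  exact ContinuousAt.comp (f := fun t : ℝ => (((1 / 2 : ℝ) : ℂ) + t * I)) h1 (by fun_prop)

/-- Moving the line of integration from `Re s = 5 / 4` to the critical line. -/
theorem integral_zetaCube_half {T : ℝ} (hT : 1 ≤ T) :
    ∫ t in (1 : ℝ)..T, zetaCube ((1 / 2 : ℝ) + t * I) =
      (∫ t in (1 : ℝ)..T, zetaCube ((5 / 4 : ℝ) + t * I)) +
        I * ((∫ σ in (1 / 2 : ℝ)..(5 / 4), zetaCube (σ + T * I)) -
          ∫ σ in (1 / 2 : ℝ)..(5 / 4), zetaCube (σ + (1 : ℝ) * I)) := by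
  have h := Complex.integral_boundary_rect_eq_zero_of_differentiableOn zetaCube
    ((1 / 2 : ℝ) + (1 : ℝ) * I) ((5 / 4 : ℝ) + T * I) (by
      intro s hs
      apply DifferentiableAt.differentiableWithinAt
      have him := hs.2
      simp [Set.uIcc_of_le hT] at him
      apply differentiableAt_zetaCube
      · rintro rfl
        simp at him
        linarith [him.1]
      · rintro rfl
        simp at him
        linarith [him.1])
  simp only [Complex.add_re, Complex.ofReal_re, Complex.mul_re, Complex.I_re, mul_zero,
    Complex.ofReal_im, Complex.I_im, mul_one, sub_self, add_zero, Complex.add_im,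
    Complex.mul_im, zero_add, smul_eq_mul] at h
  linear_combination I * h - ((∫ t in (1 : ℝ)..T, zetaCube ((5 / 4 : ℝ) + t * I)) -
    ∫ t in (1 : ℝ)..T, zetaCube ((1 / 2 : ℝ) + t * I)) * Complex.I_sq

theorem one_le_rpow_mul_log_pow {T : ℝ} (hT : 4 ≤ T) :
    T ^ ((3 : ℝ) / 4) ≤ T ^ ((3 : ℝ) / 4) * Real.log T ^ 3 ∧
      1 ≤ T ^ ((3 : ℝ) / 4) * Real.log T ^ 3 := by
  have h1 : 1 ≤ Real.log T := by
    rw [Real.le_log_iff_exp_le (by linarith)]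
    linarith [Real.exp_one_lt_d9]
  have h2 : 1 ≤ Real.log T ^ 3 := one_le_pow₀ h1
  have h3 : 1 ≤ T ^ ((3 : ℝ) / 4) := Real.one_le_rpow (by linarith) (by norm_num)
  constructor <;> nlinarith

theorem rpow_mul_log_pow_le_of_le_two_mul {t T : ℝ} (ht : 1 ≤ t) (hT : 4 ≤ T) (h : t ≤ 2 * T) :
    t ^ ((3 : ℝ) / 4) * Real.log t ^ 3 ≤ 16 * (T ^ ((3 : ℝ) / 4) * Real.log T ^ 3) := by
  have h1 : t ^ ((3 : ℝ) / 4) ≤ 2 * T ^ ((3 : ℝ) / 4) := by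
    calc t ^ ((3 : ℝ) / 4) ≤ (2 * T) ^ ((3 : ℝ) / 4) := by gcongr
      _ = 2 ^ ((3 : ℝ) / 4) * T ^ ((3 : ℝ) / 4) := Real.mul_rpow (by norm_num) (by linarith)
      _ ≤ _ := by
        gcongr
        exact Real.rpow_le_self_of_one_le (by norm_num) (by norm_num)
  have h2 : Real.log t ≤ 2 * Real.log T := by
    have : Real.log (2 * T) = Real.log 2 + Real.log T :=
      Real.log_mul (by norm_num) (by linarith)
    have h3 : Real.log 2 ≤ Real.log T := Real.log_le_log (by norm_num) (by linarith)
    have h4 : Real.log t ≤ Real.log (2 * T) := Real.log_le_log (by linarith) h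
    linarith
  have h0 : 0 ≤ Real.log t := Real.log_nonneg ht
  have h5 : Real.log t ^ 3 ≤ (2 * Real.log T) ^ 3 := by gcongr
  calc _ ≤ (2 * T ^ ((3 : ℝ) / 4)) * (2 * Real.log T) ^ 3 := by gcongr
    _ = _ := by ring

theorem exists_norm_integral_zetaCube_half_sub_le :
    ∃ C : ℝ, 0 < C ∧ ∃ T₀ : ℝ, ∀ m : ℕ, T₀ ≤ 2 * Real.pi * (m + 1 / 2) →
      ‖(∫ t in (0 : ℝ)..(2 * Real.pi * (m + 1 / 2)), zetaCube ((1 / 2 : ℝ) + t * I)) -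
        2 * Real.pi * ∑ k ∈ Finset.Icc 1 m, (d3 k : ℂ)‖ ≤
        C * ((2 * Real.pi * (m + 1 / 2)) ^ ((3 : ℝ) / 4) *
          Real.log (2 * Real.pi * (m + 1 / 2)) ^ 3) := by
  obtain ⟨C₁, hC₁, h₁⟩ := exists_norm_integral_zetaCube_five_quarters_sub_le
  obtain ⟨C₂, hC₂, T₀, hT₀, h₂⟩ := exists_norm_zetaCube_le
  set A := ∫ t in (0 : ℝ)..1, zetaCube ((1 / 2 : ℝ) + t * I) with hA
  set B := ∫ σ in (1 / 2 : ℝ)..(5 / 4), zetaCube (σ + (1 : ℝ) * I) with hB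
  refine ⟨‖A‖ + C₁ + C₂ + ‖B‖, by positivity, T₀, fun m hm => ?_⟩
  have e1 := h₁ m
  set T : ℝ := 2 * Real.pi * (m + 1 / 2) with hT
  have hT4 : 4 ≤ T := hT₀.trans hm
  obtain ⟨g1, g2⟩ := one_le_rpow_mul_log_pow hT4
  set g : ℝ := T ^ ((3 : ℝ) / 4) * Real.log T ^ 3 with hg
  have htop : ‖∫ σ in (1 / 2 : ℝ)..(5 / 4), zetaCube (σ + T * I)‖ ≤ C₂ * g := by
    have := intervalIntegral.norm_integral_le_of_norm_le_const (a := 1 / 2) (b := 5 / 4)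
      (C := C₂ * g) (f := fun σ : ℝ => zetaCube (σ + T * I)) (by
        intro σ hσ
        rw [Set.uIoc_of_le (by norm_num)] at hσ
        exact h₂ T hm σ hσ.1.le hσ.2)
    refine this.trans ?_
    have h0 : 0 ≤ C₂ * g := by positivity
    have : |(5 / 4 : ℝ) - 1 / 2| ≤ 1 := by rw [abs_of_pos] <;> norm_num
    nlinarith
  rw [← intervalIntegral.integral_add_adjacent_intervals
    (continuous_zetaCube_half.intervalIntegrable 0 1)
    (continuous_zetaCube_half.intervalIntegrable 1 T), integral_zetaCube_half (by linarith)]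
  rw [← hA, ← hB]
  set F := ∫ t in (1 : ℝ)..T, zetaCube ((5 / 4 : ℝ) + t * I)
  set P := ∫ σ in (1 / 2 : ℝ)..(5 / 4), zetaCube (σ + T * I)
  have e : A + (F + I * (P - B)) - 2 * Real.pi * ∑ k ∈ Finset.Icc 1 m, (d3 k : ℂ) =
      A + (F - 2 * Real.pi * ∑ k ∈ Finset.Icc 1 m, (d3 k : ℂ)) + I * (P - B) := by ring
  rw [e]
  have e2 : ‖I * (P - B)‖ ≤ C₂ * g + ‖B‖ := by
    rw [norm_mul, Complex.norm_I, one_mul]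
    exact (norm_sub_le _ _).trans (add_le_add_left htop _)
  refine (norm_add_le _ _).trans ((add_le_add ((norm_add_le _ _).trans
    (add_le_add_right e1 _)) e2).trans ?_)
  nlinarith [norm_nonneg A, norm_nonneg B]

theorem stmt17 :
    (fun T : ℝ =>
        (∫ t in (0:ℝ)..T, (Z t) ^ 2 * riemannZeta (1 / 2 + I * t)) -
          2 * π * ∑ k ∈ Finset.Icc 1 ⌊T / (2 * π)⌋₊, (d3 k : ℂ))
      =O[atTop] fun T : ℝ => T ^ ((3:ℝ)/4) * (Real.log T) ^ 3 := by
  obtain ⟨C₁, hC₁, T₁, h₁⟩ := exists_norm_integral_zetaCube_half_sub_le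
  obtain ⟨C₂, hC₂, T₂, hT₂, h₂⟩ := exists_norm_zetaCube_le
  refine Asymptotics.IsBigO.of_bound (C₁ * 16 + C₂ * 16 * 4) ?_
  filter_upwards [eventually_ge_atTop (max T₁ T₂ + 4)] with T hT
  have hT1 : T₁ + 4 ≤ T := le_trans (by gcongr; exact le_max_left _ _) hT
  have hT2 : T₂ + 4 ≤ T := le_trans (by gcongr; exact le_max_right _ _) hT
  have hT4 : 4 ≤ T := by linarith
  obtain ⟨-, g2⟩ := one_le_rpow_mul_log_pow hT4
  rw [Real.norm_of_nonneg (by linarith)]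
  set g : ℝ := T ^ ((3 : ℝ) / 4) * Real.log T ^ 3 with hg
  set m : ℕ := ⌊T / (2 * Real.pi)⌋₊ with hm
  have hpi := Real.pi_gt_three
  have hpi4 := Real.pi_le_four
  have hm1 : 2 * Real.pi * m ≤ T := by
    have := Nat.floor_le (show 0 ≤ T / (2 * Real.pi) by positivity)
    rw [le_div_iff₀ (by positivity)] at this
    linarith
  have hm2 : T < 2 * Real.pi * (m + 1) := by
    have := Nat.lt_floor_add_one (T / (2 * Real.pi))
    rw [div_lt_iff₀ (by positivity)] at this
    linarith
  have e1 := h₁ m (by nlinarith)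
  set U : ℝ := 2 * Real.pi * (m + 1 / 2) with hU
  have hUT : U ≤ T + 4 := by rw [hU]; linarith
  have hTU : T - 4 ≤ U := by rw [hU]; linarith
  have hUabs : |T - U| ≤ 4 := by rw [abs_le]; constructor <;> linarith
  have e2 := rpow_mul_log_pow_le_of_le_two_mul (t := U) (T := T) (by linarith) hT4 (by linarith)
  have e3 : ‖∫ t in U..T, zetaCube ((1 / 2 : ℝ) + t * I)‖ ≤ C₂ * (16 * g) * |T - U| := by
    refine intervalIntegral.norm_integral_le_of_norm_le_const fun t ht => ?_
    have ht1 : min U T < t := ht.1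
    have ht2 : t ≤ max U T := ht.2
    have ht3 : T - 4 ≤ t := (le_min hTU (by linarith)).trans ht1.le
    have ht4 : t ≤ T + 4 := ht2.trans (max_le hUT (by linarith))
    refine (h₂ t (by linarith) (1 / 2) le_rfl (by norm_num)).trans ?_
    exact mul_le_mul_of_nonneg_left (rpow_mul_log_pow_le_of_le_two_mul (t := t) (by linarith) hT4
      (by linarith)) hC₂.le
  have e4 : ∫ t in (0:ℝ)..T, (Z t) ^ 2 * riemannZeta (1 / 2 + I * t) =
      (∫ t in (0:ℝ)..U, zetaCube ((1 / 2 : ℝ) + t * I)) +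
        ∫ t in U..T, zetaCube ((1 / 2 : ℝ) + t * I) := by
    rw [intervalIntegral.integral_add_adjacent_intervals
      (continuous_zetaCube_half.intervalIntegrable _ _)
      (continuous_zetaCube_half.intervalIntegrable _ _)]
    exact intervalIntegral.integral_congr fun t _ => Z_sq_mul_riemannZeta t
  rw [e4, add_sub_right_comm]
  refine (norm_add_le _ _).trans ((add_le_add e1 e3).trans ?_)
  have e5 : C₂ * (16 * g) * |T - U| ≤ C₂ * (16 * g) * 4 := by gcongr
  have e6 : C₁ * (U ^ ((3 : ℝ) / 4) * Real.log U ^ 3) ≤ C₁ * (16 * g) := by gcongr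
  linarith
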